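/- Let s > −1/6, b > 1/2, and let b′ satisfy −1/2 < b′ < s − 1/3 if −1/6 < s ≤ 0, and −1/2 < b′ < −1/3 if s ≥ 0. Then there exists a constant C such that for all (say, Schwartz) functions u₁, u₂, u₃, u₄ : ℝ² → ℂ one has ‖∂_x(u₁u₂u₃u₄)‖_{X^{s,b′}} ≤ C ∏_{j=1}^{4} ‖u_j‖_{X^{s,b}}. -/

import Mathlib

open MeasureTheory Set
open scoped ENNReal

noncomputable section

/-- The Fourier transform `f̂(ξ) = ∫ e^{-ixξ} f(x) dx`. -/
def FT (f : ℝ → ℂ) (ξ : ℝ) : ℂ :=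
  ∫ x : ℝ, Complex.exp (-Complex.I * x * ξ) * f x

/-- The Japanese bracket power `⟨ξ⟩^s = (1 + ξ²)^(s/2)`. -/
def jap (s ξ : ℝ) : ℝ := (1 + ξ ^ 2) ^ (s / 2)

/-- The Gevrey norm `‖f‖_{G^{σ,s}} = ‖e^{σ|ξ|} ⟨ξ⟩^s f̂(ξ)‖_{L²_ξ(ℝ)}`, valued in `ℝ≥0∞`.
`f ∈ G^{σ,s}(ℝ)` means `gevreyNorm σ s f < ⊤`. -/
def gevreyNorm (σ s : ℝ) (f : ℝ → ℂ) : ℝ≥0∞ :=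
  eLpNorm (fun ξ : ℝ => ((Real.exp (σ * |ξ|) * jap s ξ : ℝ) : ℂ) * FT f ξ) 2 volume

/-- The space-time Fourier transform `ũ(τ,ξ) = ∫_{ℝ²} e^{i(tτ+xξ)} u(t,x) dt dx`
(for `u` written in curried form, first variable `t`, second `x`). -/
def FT2 (u : ℝ → ℝ → ℂ) (τ ξ : ℝ) : ℂ :=
  ∫ p : ℝ × ℝ, Complex.exp (Complex.I * (p.1 * τ + p.2 * ξ)) * u p.1 p.2

/-- The Gevrey–Bourgain norm
`‖u‖_{X^{σ,s,b}} = ‖e^{σ|D_x|}u‖_{X^{s,b}} = ‖e^{σ|ξ|} ⟨ξ⟩^s ⟨τ-ξ³⟩^b ũ(τ,ξ)‖_{L²_{τ,ξ}}`.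
Taking `σ = 0` gives the Bourgain norm `‖u‖_{X^{s,b}}`. -/
def XNorm (σ s b : ℝ) (u : ℝ → ℝ → ℂ) : ℝ≥0∞ :=
  eLpNorm (fun p : ℝ × ℝ =>
    ((Real.exp (σ * |p.2|) * jap s p.2 * jap b (p.1 - p.2 ^ 3) : ℝ) : ℂ) * FT2 u p.1 p.2)
    2 volume

/-- The restriction norm `‖u‖_{X^{σ,s,b}_δ} = inf {‖v‖_{X^{σ,s,b}} : v = u on ℝ × (0,δ)}`. -/
def XRestNorm (σ s b δ : ℝ) (u : ℝ → ℝ → ℂ) : ℝ≥0∞ :=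
  sInf {r : ℝ≥0∞ | ∃ v : ℝ → ℝ → ℂ, (∀ t ∈ Set.Ioo 0 δ, v t = u t) ∧ XNorm σ s b v = r}

/-- `u : ℝ → ℝ → E` (curried) is a Schwartz function of the pair of variables. -/
def IsSchwartz {E : Type*} [NormedAddCommGroup E] [NormedSpace ℝ E] (u : ℝ → ℝ → E) : Prop :=
  ∃ φ : SchwartzMap (ℝ × ℝ) E, ∀ t x, u t x = φ (t, x)

open FourierTransform LineDeriv Convolution SchwartzMap
open scoped NNReal

/-- The space-time Fourier transform of a Schwartz function, uncurried. -/
def ft (φ : 𝓢(ℝ × ℝ, ℂ)) (p : ℝ × ℝ) : ℂ := FT2 (fun t x => φ (t, x)) p.1 p.2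

/-- A Schwartz function on `ℝ × ℝ`, transported to the Euclidean plane. -/
def toEuc : 𝓢(ℝ × ℝ, ℂ) →L[ℂ] 𝓢(WithLp 2 (ℝ × ℝ), ℂ) :=
  SchwartzMap.compCLMOfContinuousLinearEquiv ℂ (WithLp.prodContinuousLinearEquiv 2 ℝ ℝ ℝ)

lemma toEuc_apply (φ : 𝓢(ℝ × ℝ, ℂ)) (w : WithLp 2 (ℝ × ℝ)) : toEuc φ w = φ (w.fst, w.snd) := rfl

lemma ft_eq_fourierInv (φ : 𝓢(ℝ × ℝ, ℂ)) (p : ℝ × ℝ) :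
    ft φ p = 𝓕⁻ (toEuc φ) ((2 * Real.pi)⁻¹ • WithLp.toLp 2 p) := by
  rw [SchwartzMap.fourierInv_coe, Real.fourierInv_eq', ft, FT2,
    ← (WithLp.volume_preserving_ofLp ℝ ℝ).integral_comp
      (MeasurableEquiv.toLp 2 (ℝ × ℝ)).symm.measurableEmbedding]
  refine integral_congr_ae (Filter.Eventually.of_forall fun w => ?_)
  simp only [toEuc_apply, smul_eq_mul]
  congr 2
  have h : inner ℝ w ((2 * Real.pi)⁻¹ • WithLp.toLp 2 p) =
      (2 * Real.pi)⁻¹ * (w.fst * p.1 + w.snd * p.2) := by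
    simp [inner_smul_right, WithLp.prod_inner_apply]
    ring
  rw [h, ← mul_assoc, mul_inv_cancel₀ (by positivity)]
  push_cast
  simp only [WithLp.fst, WithLp.snd]
  ring

lemma continuous_ft (φ : 𝓢(ℝ × ℝ, ℂ)) : Continuous (ft φ) := by
  have : ft φ = fun p => 𝓕⁻ (toEuc φ) ((2 * Real.pi)⁻¹ • WithLp.toLp 2 p) :=
    funext (ft_eq_fourierInv φ)
  rw [this]
  have h : Continuous fun p : ℝ × ℝ => (2 * Real.pi)⁻¹ • WithLp.toLp 2 p :=
    (WithLp.prod_continuous_toLp 2 ℝ ℝ).fun_const_smul _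
  exact (𝓕⁻ (toEuc φ)).continuous.comp h

/-- The pointwise product of two Schwartz functions. -/
def schwartzMul (φ ψ : 𝓢(ℝ × ℝ, ℂ)) : 𝓢(ℝ × ℝ, ℂ) :=
  SchwartzMap.pairing (ContinuousLinearMap.mul ℂ ℂ) φ ψ

lemma schwartzMul_apply (φ ψ : 𝓢(ℝ × ℝ, ℂ)) (p : ℝ × ℝ) : schwartzMul φ ψ p = φ p * ψ p := by
  simp [schwartzMul, SchwartzMap.pairing_apply_apply]

lemma enorm_ft_mul_le (φ ψ : 𝓢(ℝ × ℝ, ℂ)) (p : ℝ × ℝ) :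
    ‖ft (schwartzMul φ ψ) p‖ₑ ≤ ∫⁻ q, ‖ft φ q‖ₑ * ‖ft ψ (p - q)‖ₑ := by
  have h1 : 𝓕⁻ (toEuc (schwartzMul φ ψ)) =
      SchwartzMap.convolution (ContinuousLinearMap.mul ℂ ℂ)
        (𝓕⁻ (toEuc φ)) (𝓕⁻ (toEuc ψ)) := by
    have : toEuc (schwartzMul φ ψ) =
        SchwartzMap.pairing (ContinuousLinearMap.mul ℂ ℂ) (toEuc φ) (toEuc ψ) := by
      ext w
      simp [toEuc_apply, schwartzMul_apply, SchwartzMap.pairing_apply_apply]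
    rw [this]
    simp [SchwartzMap.convolution]
  have h2 : ft (schwartzMul φ ψ) p =
      |((2 * Real.pi)⁻¹ ^ 2)| • ∫ q, ft φ q * ft ψ (p - q) := by
    rw [ft_eq_fourierInv, h1, SchwartzMap.convolution_apply, MeasureTheory.convolution_def,
      ← (WithLp.volume_preserving_ofLp ℝ ℝ).integral_comp
      (MeasurableEquiv.toLp 2 (ℝ × ℝ)).symm.measurableEmbedding]
    have h3 := Measure.integral_comp_smul (volume : Measure (WithLp 2 (ℝ × ℝ)))
      (fun t => 𝓕⁻ (toEuc φ) t *
        𝓕⁻ (toEuc ψ) ((2 * Real.pi)⁻¹ • WithLp.toLp 2 p - t)) (2 * Real.pi)⁻¹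
    have h4 : Module.finrank ℝ (WithLp 2 (ℝ × ℝ)) = 2 := by
      rw [(WithLp.linearEquiv 2 ℝ (ℝ × ℝ)).finrank_eq]; simp
    rw [h4] at h3
    have h5 : ∀ w : WithLp 2 (ℝ × ℝ), ft φ w.ofLp * ft ψ (p - w.ofLp) =
        𝓕⁻ (toEuc φ) ((2 * Real.pi)⁻¹ • w) *
        𝓕⁻ (toEuc ψ) ((2 * Real.pi)⁻¹ • WithLp.toLp 2 p - (2 * Real.pi)⁻¹ • w) := by
      intro w
      rw [ft_eq_fourierInv, ft_eq_fourierInv, ← smul_sub]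
      rfl
    simp_rw [h5]
    rw [h3, smul_smul, ← abs_mul, mul_inv_cancel₀ (a := (2 * Real.pi)⁻¹ ^ 2) (by positivity)]
    simp
  rw [h2, enorm_smul]
  have h6 : ‖|((2 * Real.pi)⁻¹ ^ 2)|‖ₑ ≤ 1 := by
    have hpi : (2 * Real.pi)⁻¹ ≤ 1 := inv_le_one_of_one_le₀ (by linarith [Real.pi_gt_three])
    rw [← ofReal_norm, Real.norm_eq_abs, abs_abs, abs_of_nonneg (by positivity),
      ← ENNReal.ofReal_one]
    exact ENNReal.ofReal_le_ofReal (pow_le_one₀ (by positivity) hpi)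
  calc _ ≤ 1 * ‖∫ q, ft φ q * ft ψ (p - q)‖ₑ := by gcongr
    _ ≤ _ := by
      rw [one_mul]
      refine (enorm_integral_le_lintegral_enorm _).trans_eq ?_
      simp [enorm_mul]

lemma enorm_ft_lineDeriv (φ : 𝓢(ℝ × ℝ, ℂ)) (p : ℝ × ℝ) :
    ‖ft (∂_{((0 : ℝ), (1 : ℝ))} φ) p‖ₑ = ENNReal.ofReal |p.2| * ‖ft φ p‖ₑ := by
  have h : toEuc (∂_{((0 : ℝ), (1 : ℝ))} φ) =
      ∂_{WithLp.toLp 2 ((0 : ℝ), (1 : ℝ))} (toEuc φ) := by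
    rw [toEuc, SchwartzMap.lineDerivOp_compCLMOfContinuousLinearEquiv]
    rfl
  have h' : (fun w : WithLp 2 (ℝ × ℝ) =>
    (inner ℝ w (WithLp.toLp 2 ((0 : ℝ), (1 : ℝ))) : ℝ)).HasTemperateGrowth := by fun_prop
  rw [ft_eq_fourierInv, h, SchwartzMap.fourierInv_lineDerivOp_eq, ft_eq_fourierInv]
  simp only [_root_.smul_apply, SchwartzMap.smulLeftCLM_apply_apply h', enorm_smul]
  rw [← mul_assoc]
  congr 1
  have h2 : (inner ℝ ((2 * Real.pi)⁻¹ • WithLp.toLp 2 p) (WithLp.toLp 2 ((0 : ℝ), (1 : ℝ))) : ℝ) =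
      (2 * Real.pi)⁻¹ * p.2 := by
    simp [inner_smul_left, WithLp.prod_inner_apply]
  rw [h2, ← ofReal_norm, ← ofReal_norm, ← ENNReal.ofReal_mul (norm_nonneg _)]
  congr 1
  simp only [norm_neg, norm_mul, Real.norm_eq_abs, Complex.norm_I, Complex.norm_real,
    Complex.norm_ofNat, abs_inv, abs_of_pos Real.pi_pos, abs_of_pos Real.two_pi_pos]
  field_simp

lemma deriv_eq_lineDeriv (φ : 𝓢(ℝ × ℝ, ℂ)) (t x : ℝ) :
    deriv (fun y => φ (t, y)) x = (∂_{((0 : ℝ), (1 : ℝ))} φ) (t, x) := by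
  rw [SchwartzMap.lineDerivOp_apply_eq_fderiv]
  have h1 : HasDerivAt (fun y : ℝ => (t, y)) ((0 : ℝ), (1 : ℝ)) x :=
    (hasDerivAt_const x t).prodMk (hasDerivAt_id x)
  exact (φ.differentiableAt.hasFDerivAt.comp_hasDerivAt x h1).deriv

lemma enorm_FT2_deriv_mul_le (φ₁ φ₂ φ₃ φ₄ : 𝓢(ℝ × ℝ, ℂ)) (p : ℝ × ℝ) :
    ‖FT2 (fun t x => deriv (fun y => φ₁ (t, y) * φ₂ (t, y) * φ₃ (t, y) * φ₄ (t, y)) x) p.1 p.2‖ₑ ≤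
      ENNReal.ofReal |p.2| * ∫⁻ p₁, ‖ft φ₁ p₁‖ₑ * ∫⁻ p₂, ‖ft φ₂ p₂‖ₑ *
        ∫⁻ p₃, ‖ft φ₃ p₃‖ₑ * ‖ft φ₄ (p - p₁ - p₂ - p₃)‖ₑ := by
  have h : FT2 (fun t x => deriv (fun y => φ₁ (t, y) * φ₂ (t, y) * φ₃ (t, y) * φ₄ (t, y)) x) p.1 p.2
      = ft (∂_{((0 : ℝ), (1 : ℝ))}
          (schwartzMul φ₁ (schwartzMul φ₂ (schwartzMul φ₃ φ₄)))) p := by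
    rw [ft]
    congr 1
    ext t x
    rw [← deriv_eq_lineDeriv]
    simp only [schwartzMul_apply, mul_assoc]
  rw [h, enorm_ft_lineDeriv]
  gcongr
  refine (enorm_ft_mul_le _ _ _).trans (lintegral_mono fun p₁ => ?_)
  gcongr
  refine (enorm_ft_mul_le _ _ _).trans (lintegral_mono fun p₂ => ?_)
  gcongr
  exact enorm_ft_mul_le _ _ _

lemma jap_pos (s x : ℝ) : 0 < jap s x := by unfold jap; positivity

lemma jap_nonneg (s x : ℝ) : 0 ≤ jap s x := (jap_pos s x).le

lemma continuous_jap (s : ℝ) : Continuous (jap s) := by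
  unfold jap
  exact Continuous.rpow_const (by fun_prop) fun x => Or.inl (by positivity)

@[fun_prop]
lemma measurable_jap (s : ℝ) : Measurable (jap s) := (continuous_jap s).measurable

lemma jap_add (s t x : ℝ) : jap (s + t) x = jap s x * jap t x := by
  rw [jap, add_div, Real.rpow_add (by positivity)]; rfl

lemma jap_zero (x : ℝ) : jap 0 x = 1 := by simp [jap]

lemma jap_two (x : ℝ) : jap 2 x = 1 + x ^ 2 := by simp [jap]

lemma jap_sq (s x : ℝ) : jap s x ^ 2 = jap (2 * s) x := by rw [two_mul, jap_add, sq]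

lemma jap_neg (s x : ℝ) : jap s (-x) = jap s x := by simp [jap]

lemma jap_mono_left {s t : ℝ} (h : s ≤ t) (x : ℝ) : jap s x ≤ jap t x :=
  Real.rpow_le_rpow_of_exponent_le (by nlinarith [sq_nonneg x]) (by linarith)

lemma jap_le_one {s : ℝ} (h : s ≤ 0) (x : ℝ) : jap s x ≤ 1 :=
  (jap_mono_left h x).trans_eq (jap_zero x)

lemma one_le_jap {s : ℝ} (h : 0 ≤ s) (x : ℝ) : 1 ≤ jap s x :=
  (jap_zero x).symm.trans_le (jap_mono_left h x)

lemma jap_le_of_le {s c x y : ℝ} (hs : 0 ≤ s) (hc : 0 ≤ c) (h : 1 + x ^ 2 ≤ c * (1 + y ^ 2)) :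
    jap s x ≤ c ^ (s / 2) * jap s y := by
  rw [jap, jap, ← Real.mul_rpow hc (by positivity)]
  exact Real.rpow_le_rpow (by positivity) h (by positivity)

lemma jap_neg_le_of_le {s c x y : ℝ} (hs : 0 ≤ s) (hc : 0 ≤ c)
    (h : 1 + x ^ 2 ≤ c * (1 + y ^ 2)) : jap (-s) y ≤ c ^ (s / 2) * jap (-s) x := by
  have h1 : jap (-s) y * jap s y = 1 := by rw [← jap_add, neg_add_cancel, jap_zero]
  have h2 : jap (-s) x * jap s x = 1 := by rw [← jap_add, neg_add_cancel, jap_zero]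
  have h3 := jap_le_of_le hs hc h
  calc jap (-s) y = jap (-s) y * jap (-s) x * jap s x := by rw [mul_assoc, h2, mul_one]
    _ ≤ jap (-s) y * jap (-s) x * (c ^ (s / 2) * jap s y) := by
      gcongr
      exact mul_nonneg (jap_nonneg _ _) (jap_nonneg _ _)
    _ = c ^ (s / 2) * jap (-s) x * (jap (-s) y * jap s y) := by ring
    _ = _ := by rw [h1, mul_one]

lemma exists_lintegral_jap_le {r : ℝ} (hr : 1 < r) :
    ∃ C : ℝ≥0, ∀ z, ∫⁻ x, ENNReal.ofReal (jap (-r) (x - z)) ≤ C := by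
  have h : Integrable (fun x : ℝ => jap (-r) x) := by
    have := integrable_rpow_neg_one_add_norm_sq (E := ℝ) (μ := volume) (r := r) (by simpa using hr)
    simpa [jap, neg_div] using this
  refine ⟨(∫⁻ x, ENNReal.ofReal (jap (-r) x)).toNNReal, fun z => ?_⟩
  rw [ENNReal.coe_toNNReal h.lintegral_lt_top.ne]
  exact (lintegral_sub_right_eq_self (fun x => ENNReal.ofReal (jap (-r) x)) z).le

lemma jap_mul_jap_le {r : ℝ} (hr : 0 ≤ r) (u v : ℝ) :
    jap (-r) u * jap (-r) v ≤ 4 ^ (r / 2) * jap (-r) (u + v) * (jap (-r) u + jap (-r) v) := by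
  have key : ∀ u v : ℝ, u ^ 2 ≤ v ^ 2 →
      jap (-r) u * jap (-r) v ≤ 4 ^ (r / 2) * jap (-r) (u + v) * jap (-r) u := by
    intro u v h
    rw [mul_comm]
    gcongr
    · exact jap_nonneg _ _
    · exact jap_neg_le_of_le hr (by norm_num) (by nlinarith [sq_nonneg (u - v)])
  have p : 0 ≤ 4 ^ (r / 2) * jap (-r) (u + v) := mul_nonneg (by positivity) (jap_nonneg _ _)
  have p1 := mul_nonneg p (jap_nonneg (-r) u)
  have p2 := mul_nonneg p (jap_nonneg (-r) v)
  rcases le_total (u ^ 2) (v ^ 2) with h | h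
  · linarith [key u v h]
  · have := key v u h
    rw [add_comm v u] at this
    linarith

/-- The convolution of two integrable bracket powers is controlled by the same power. -/
lemma exists_lintegral_jap_mul_jap_le {r : ℝ} (hr : 1 < r) :
    ∃ C : ℝ≥0, ∀ x z, ∫⁻ y, ENNReal.ofReal (jap (-r) (y - x) * jap (-r) (z - y)) ≤
      C * ENNReal.ofReal (jap (-r) (z - x)) := by
  obtain ⟨C, hC⟩ := exists_lintegral_jap_le hr
  refine ⟨(4 ^ (r / 2) : ℝ).toNNReal * (2 * C), fun x z => ?_⟩
  have h1 : ∀ y, ENNReal.ofReal (jap (-r) (y - x) * jap (-r) (z - y)) ≤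
      ENNReal.ofReal (4 ^ (r / 2) * jap (-r) (z - x)) *
        (ENNReal.ofReal (jap (-r) (y - x)) + ENNReal.ofReal (jap (-r) (y - z))) := by
    intro y
    rw [← ENNReal.ofReal_add (jap_nonneg _ _) (jap_nonneg _ _),
      ← ENNReal.ofReal_mul (mul_nonneg (by positivity) (jap_nonneg _ _))]
    apply ENNReal.ofReal_le_ofReal
    have := jap_mul_jap_le (zero_le_one.trans hr.le) (y - x) (z - y)
    rw [show y - x + (z - y) = z - x by ring] at this
    rwa [show jap (-r) (y - z) = jap (-r) (z - y) by rw [← jap_neg, neg_sub]]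
  refine (lintegral_mono h1).trans ?_
  rw [lintegral_const_mul _ (by fun_prop), lintegral_add_left (by fun_prop),
    ENNReal.ofReal_mul (by positivity)]
  calc _ ≤ ENNReal.ofReal (4 ^ (r / 2)) * ENNReal.ofReal (jap (-r) (z - x)) * (C + C) := by
        gcongr
        · exact hC x
        · exact hC z
    _ = _ := by
      push_cast
      rw [ENNReal.ofReal]
      ring

/-- A change of variables in the phase `x ↦ x ^ 3 + (e - x) ^ 3`, whose derivative is
`3 (x ^ 2 - (e - x) ^ 2)`. -/
lemma exists_lintegral_phase_le {r : ℝ} (hr : 1 < r) :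
    ∃ C : ℝ≥0, ∀ e T : ℝ, ∫⁻ x, ENNReal.ofReal (|x ^ 2 - (e - x) ^ 2| *
      jap (-r) (T - x ^ 3 - (e - x) ^ 3)) ≤ C := by
  obtain ⟨C, hC⟩ := exists_lintegral_jap_le hr
  refine ⟨2 * C, fun e T => ?_⟩
  rcases eq_or_ne e 0 with rfl | he
  · simp
  set g : ℝ → ℝ := fun x => x ^ 3 + (e - x) ^ 3 with hg
  have hd : ∀ x, HasDerivAt g (3 * (x ^ 2 - (e - x) ^ 2)) x := by
    intro x
    have := ((hasDerivAt_id x).pow 3).add (((hasDerivAt_id x).const_sub e).pow 3)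
    convert! this using 1
    simp only [id_eq]
    push_cast
    ring
  have hinj : ∀ x y, g x = g y → x = y ∨ x + y = e := by
    intro x y h
    have : e * ((x - y) * (x + y - e)) = 0 := by
      simp only [hg] at h
      linear_combination h / 3
    rcases mul_eq_zero.1 this with h | h
    · exact absurd h he
    · rcases mul_eq_zero.1 h with h | h
      · exact Or.inl (by linarith)
      · exact Or.inr (by linarith)
  have hS : ∀ s : Set ℝ, MeasurableSet s → InjOn g s →
      ∫⁻ x in s, ENNReal.ofReal (|x ^ 2 - (e - x) ^ 2| *
        jap (-r) (T - x ^ 3 - (e - x) ^ 3)) ≤ C := by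
    intro s hs hi
    calc _ ≤ ∫⁻ x in s, ENNReal.ofReal |3 * (x ^ 2 - (e - x) ^ 2)| *
          ENNReal.ofReal (jap (-r) (g x - T)) := by
          refine lintegral_mono fun x => ?_
          rw [← ENNReal.ofReal_mul (abs_nonneg _)]
          apply ENNReal.ofReal_le_ofReal
          rw [← jap_neg, show -(T - x ^ 3 - (e - x) ^ 3) = g x - T by simp only [hg]; ring, abs_mul]
          gcongr
          · exact jap_nonneg _ _
          · rw [abs_of_pos (by norm_num : (0 : ℝ) < 3)]
            linarith [abs_nonneg (x ^ 2 - (e - x) ^ 2)]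
      _ = ∫⁻ y in g '' s, ENNReal.ofReal (jap (-r) (y - T)) :=
          (lintegral_image_eq_lintegral_abs_deriv_mul hs
            (fun x _ => (hd x).hasDerivWithinAt) hi
            (fun y => ENNReal.ofReal (jap (-r) (y - T)))).symm
      _ ≤ _ := (setLIntegral_le_lintegral _ _).trans (hC T)
  rw [← lintegral_add_compl _ (measurableSet_Iic (a := e / 2)), compl_Iic]
  push_cast
  rw [two_mul]
  refine add_le_add (hS _ measurableSet_Iic ?_) (hS _ measurableSet_Ioi ?_)
  · intro x hx y hy h
    simp only [mem_Iic] at hx hy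
    rcases hinj x y h with h | h <;> linarith
  · intro x hx y hy h
    simp only [mem_Ioi] at hx hy
    rcases hinj x y h with h | h <;> linarith

lemma exists_lintegral_jap_mul_rpow_le {η : ℝ} (h0 : 0 < η) (h1 : η < 1) :
    ∃ C : ℝ≥0, ∀ z, ∫⁻ x, ENNReal.ofReal (jap (-(3 * η)) x * |x - z| ^ (-(1 - η))) ≤ C := by
  obtain ⟨C, hC⟩ := exists_lintegral_jap_le (r := 1 + 2 * η) (by linarith)
  have hint : IntegrableOn (fun x : ℝ => |x| ^ (-(1 - η))) (Ioo (-1) 1) := by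
    have hr : IntegrableOn (fun x : ℝ => |x| ^ (-(1 - η))) (Ioo 0 1) := by
      refine ((intervalIntegral.integrableOn_Ioo_rpow_iff zero_lt_one).2
        (by linarith : -1 < -(1 - η))).congr_fun (fun x hx => ?_) measurableSet_Ioo
      simp only [abs_of_pos hx.1]
    have hl : IntegrableOn (fun x : ℝ => |x| ^ (-(1 - η))) (Ioo (-1) 0) := by
      have := (Measure.measurePreserving_neg (volume : Measure ℝ)).integrableOn_comp_preimage
        (MeasurableEquiv.neg ℝ).measurableEmbedding (f := fun x : ℝ => |x| ^ (-(1 - η)))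
        (s := Ioo 0 1)
      simpa [Function.comp_def] using this.2 hr
    rw [← Ioo_union_Ico_eq_Ioo (b := 0) (by norm_num) (by norm_num)]
    refine hl.union ?_
    rwa [integrableOn_Ico_iff_integrableOn_Ioo]
  set D := (∫⁻ x in Ioo (-1 : ℝ) 1, ENNReal.ofReal (|x| ^ (-(1 - η)))).toNNReal with hD
  have hD' : (D : ℝ≥0∞) = ∫⁻ x in Ioo (-1 : ℝ) 1, ENNReal.ofReal (|x| ^ (-(1 - η))) := by
    rw [hD, ENNReal.coe_toNNReal]
    exact hint.lintegral_lt_top.ne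
  refine ⟨D + (2 ^ ((1 - η) / 2) : ℝ).toNNReal * (2 * C), fun z => ?_⟩
  have hpt : ∀ x, ENNReal.ofReal (jap (-(3 * η)) x * |x - z| ^ (-(1 - η))) ≤
      (Ioo (-1 : ℝ) 1).indicator (fun y => ENNReal.ofReal (|y| ^ (-(1 - η)))) (x - z) +
        ENNReal.ofReal (2 ^ ((1 - η) / 2)) * (ENNReal.ofReal (jap (-(1 + 2 * η)) (x - 0)) +
          ENNReal.ofReal (jap (-(1 + 2 * η)) (x - z))) := by
    intro x
    by_cases hx : x - z ∈ Ioo (-1 : ℝ) 1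
    · rw [indicator_of_mem hx]
      refine le_add_right (ENNReal.ofReal_le_ofReal ?_)
      exact mul_le_of_le_one_left (by positivity) (jap_le_one (by linarith) _)
    · rw [indicator_of_notMem hx, zero_add, sub_zero,
        ← ENNReal.ofReal_add (jap_nonneg _ _) (jap_nonneg _ _),
        ← ENNReal.ofReal_mul (by positivity)]
      apply ENNReal.ofReal_le_ofReal
      have hx1 : 1 ≤ |x - z| := by
        by_contra! h
        exact hx (abs_lt.1 h)
      have h2 : |x - z| ^ (-(1 - η)) ≤ 2 ^ ((1 - η) / 2) * jap (-(1 - η)) (x - z) := by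
        rw [jap, neg_div, Real.rpow_neg (abs_nonneg _), Real.rpow_neg (by positivity),
          ← div_eq_mul_inv, inv_eq_one_div, div_le_div_iff₀ (by positivity) (by positivity), one_mul,
          ← sq_abs, show |x - z| ^ (1 - η) = (|x - z| ^ 2) ^ ((1 - η) / 2) by
            rw [← Real.rpow_natCast_mul (abs_nonneg _)]; congr 1; push_cast; ring,
          ← Real.mul_rpow (by norm_num) (by positivity)]
        exact Real.rpow_le_rpow (by positivity) (by nlinarith) (by linarith)
      have h3 : jap (-(3 * η)) x * jap (-(1 - η)) (x - z) ≤
          jap (-(1 + 2 * η)) x + jap (-(1 + 2 * η)) (x - z) := by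
        rcases le_total (x ^ 2) ((x - z) ^ 2) with h | h
        · have := jap_neg_le_of_le (s := 1 - η) (c := 1) (by linarith) zero_le_one
            (show 1 + x ^ 2 ≤ 1 * (1 + (x - z) ^ 2) by linarith)
          rw [Real.one_rpow, one_mul] at this
          calc _ ≤ jap (-(3 * η)) x * jap (-(1 - η)) x := by
                gcongr
                exact jap_nonneg _ _
            _ = jap (-(1 + 2 * η)) x := by rw [← jap_add]; congr 1; ring
            _ ≤ _ := le_add_of_nonneg_right (jap_nonneg _ _)
        · have := jap_neg_le_of_le (s := 3 * η) (c := 1) (by linarith) zero_le_one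
            (show 1 + (x - z) ^ 2 ≤ 1 * (1 + x ^ 2) by linarith)
          rw [Real.one_rpow, one_mul] at this
          calc _ ≤ jap (-(3 * η)) (x - z) * jap (-(1 - η)) (x - z) := by
                gcongr
                exact jap_nonneg _ _
            _ = jap (-(1 + 2 * η)) (x - z) := by rw [← jap_add]; congr 1; ring
            _ ≤ _ := le_add_of_nonneg_left (jap_nonneg _ _)
      calc _ ≤ jap (-(3 * η)) x * (2 ^ ((1 - η) / 2) * jap (-(1 - η)) (x - z)) := by
            gcongr
            exact jap_nonneg _ _
        _ = 2 ^ ((1 - η) / 2) * (jap (-(3 * η)) x * jap (-(1 - η)) (x - z)) := by ring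
        _ ≤ _ := by gcongr
  refine (lintegral_mono hpt).trans ?_
  have hm : Measurable ((Ioo (-1 : ℝ) 1).indicator
      (fun y => ENNReal.ofReal (|y| ^ (-(1 - η))))) :=
    Measurable.indicator (by fun_prop) measurableSet_Ioo
  rw [lintegral_add_left (by fun_prop), lintegral_const_mul _ (by fun_prop),
    lintegral_add_left (by fun_prop),
    lintegral_sub_right_eq_self (fun x => (Ioo (-1 : ℝ) 1).indicator
      (fun y => ENNReal.ofReal (|y| ^ (-(1 - η)))) x) z,
    lintegral_indicator measurableSet_Ioo, ← hD']
  push_cast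
  rw [two_mul (C : ℝ≥0∞)]
  gcongr
  · exact le_rfl
  · exact hC 0
  · exact hC z

lemma jap_eq_rpow (s x : ℝ) : jap s x = jap 1 x ^ s := by
  rw [jap, jap, ← Real.rpow_mul (by positivity)]
  congr 1
  ring

lemma jap_mul_rpow_le {η a c : ℝ} (h0 : 0 < η) (h1 : η < 1) (hca : |c| < |a|) :
    jap (1 - 3 * η) a * (|a| - |c|) ^ (1 - η) ≤ 4 * (|a ^ 2 - c ^ 2| + jap (-2) a) := by
  have hD : 0 < |a| - |c| := by linarith
  have hX : |a ^ 2 - c ^ 2| = (|a| - |c|) * (|a| + |c|) := by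
    rw [← sq_abs a, ← sq_abs c, sq_sub_sq, abs_mul, abs_of_pos hD, abs_of_nonneg (by positivity)]
    ring
  have hc := abs_nonneg c
  rw [hX, jap_eq_rpow, jap_eq_rpow (-2)]
  set n := jap 1 a with hn
  have hn1 : 1 ≤ n := one_le_jap zero_le_one a
  have hn0 : 0 < n := by linarith
  have hn2 : n ^ 2 = 1 + a ^ 2 := by rw [hn, jap_sq, mul_one, jap_two]
  set D := |a| - |c| with hDdef
  have hX0 : 0 ≤ D * (|a| + |c|) := by positivity
  have hm2 : n ^ (-2 : ℝ) = (n ^ 2)⁻¹ := by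
    rw [Real.rpow_neg hn0.le]; norm_cast
  have hm0 : 0 < n ^ (-2 : ℝ) := by positivity
  rcases le_total (n ^ (-3 : ℝ)) D with h | h
  · have h2 : n ^ (1 - 3 * η) * D ^ (1 - η) ≤ D * n := by
      have h3 : D ^ (-η) ≤ n ^ (3 * η) := by
        calc D ^ (-η) ≤ (n ^ (-3 : ℝ)) ^ (-η) :=
              Real.rpow_le_rpow_of_nonpos (by positivity) h (by linarith)
          _ = n ^ (3 * η) := by rw [← Real.rpow_mul hn0.le]; congr 1; ring
      calc n ^ (1 - 3 * η) * D ^ (1 - η) = n ^ (1 - 3 * η) * (D * D ^ (-η)) := by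
            rw [sub_eq_add_neg 1 η, Real.rpow_add hD, Real.rpow_one]
        _ ≤ n ^ (1 - 3 * η) * (D * n ^ (3 * η)) := by gcongr
        _ = D * (n ^ (1 - 3 * η) * n ^ (3 * η)) := by ring
        _ = D * n := by rw [← Real.rpow_add hn0, sub_add_cancel, Real.rpow_one]
    rcases le_total 1 |a| with ha | ha
    · have hna : n ≤ 2 * |a| := by
        refine le_of_sq_le_sq ?_ (by positivity)
        rw [hn2, mul_pow, sq_abs]
        nlinarith [sq_abs a]
      nlinarith [mul_le_mul_of_nonneg_left hna hD.le, mul_nonneg hD.le hc]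
    · have hna : n ^ 2 ≤ 2 := by rw [hn2, ← sq_abs]; nlinarith [abs_nonneg a]
      have h4 : 1 / 2 ≤ n ^ (-2 : ℝ) := by
        rw [hm2, one_div]; gcongr
      have hD1 : D ≤ 1 := by linarith
      have hn3 : n ≤ 2 := by nlinarith
      nlinarith [mul_le_mul hD1 hn3 hn0.le zero_le_one]
  · calc n ^ (1 - 3 * η) * D ^ (1 - η) ≤ n ^ (1 - 3 * η) * (n ^ (-3 : ℝ)) ^ (1 - η) := by gcongr
      _ = n ^ (-2 : ℝ) := by
        rw [← Real.rpow_mul hn0.le, ← Real.rpow_add hn0]; congr 1; ring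
      _ ≤ _ := by linarith

/-- An integrable weight in `b`, singular at the points where the three frequencies
`a`, `b`, `c` with `a + b + c = ξ` may have equal modulus. -/
def resWeight (η ξ b : ℝ) : ℝ :=
  jap (-(3 * η)) b * |b - ξ| ^ (-(1 - η)) + jap (-(3 * η)) b * |b - -ξ| ^ (-(1 - η)) +
    jap (-(3 * η)) b * |b - ξ / 3| ^ (-(1 - η)) + jap (-(3 * η)) b * |b - -ξ / 3| ^ (-(1 - η))

lemma resWeight_nonneg (η ξ b : ℝ) : 0 ≤ resWeight η ξ b := by
  have := jap_nonneg (-(3 * η)) b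
  unfold resWeight
  positivity

@[fun_prop]
lemma measurable_resWeight (η ξ : ℝ) : Measurable (resWeight η ξ) := by
  unfold resWeight
  fun_prop

lemma exists_lintegral_resWeight_le {η : ℝ} (h0 : 0 < η) (h1 : η < 1) :
    ∃ C : ℝ≥0, ∀ ξ, ∫⁻ b, ENNReal.ofReal (resWeight η ξ b) ≤ C := by
  obtain ⟨C, hC⟩ := exists_lintegral_jap_mul_rpow_le h0 h1
  refine ⟨C + C + C + C, fun ξ => ?_⟩
  have hp : ∀ b z : ℝ, 0 ≤ jap (-(3 * η)) b * |b - z| ^ (-(1 - η)) := fun b z =>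
    mul_nonneg (jap_nonneg _ _) (by positivity)
  have : ∀ b, ENNReal.ofReal (resWeight η ξ b) =
      ENNReal.ofReal (jap (-(3 * η)) b * |b - ξ| ^ (-(1 - η))) +
      ENNReal.ofReal (jap (-(3 * η)) b * |b - -ξ| ^ (-(1 - η))) +
      ENNReal.ofReal (jap (-(3 * η)) b * |b - ξ / 3| ^ (-(1 - η))) +
      ENNReal.ofReal (jap (-(3 * η)) b * |b - -ξ / 3| ^ (-(1 - η))) := by
    intro b
    rw [← ENNReal.ofReal_add (hp _ _) (hp _ _),
      ← ENNReal.ofReal_add (add_nonneg (hp _ _) (hp _ _)) (hp _ _),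
      ← ENNReal.ofReal_add (add_nonneg (add_nonneg (hp _ _) (hp _ _)) (hp _ _)) (hp _ _)]
    rfl
  simp_rw [this]
  rw [lintegral_add_left (by fun_prop), lintegral_add_left (by fun_prop),
    lintegral_add_left (by fun_prop)]
  push_cast
  gcongr <;> exact hC _

lemma exists_abs_sub_le {a b c ξ : ℝ} (hξ : a + b + c = ξ) (hcb : |c| ≤ |b|) (hba : |b| ≤ |a|) :
    |b - ξ| ≤ |a| - |c| ∨ |b - -ξ| ≤ |a| - |c| ∨ |b - ξ / 3| ≤ |a| - |c| ∨
      |b - -ξ / 3| ≤ |a| - |c| := by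
  subst hξ
  rcases abs_cases a with ⟨ha, ha'⟩ | ⟨ha, ha'⟩ <;> rcases abs_cases b with ⟨hb, hb'⟩ | ⟨hb, hb'⟩ <;>
    rcases abs_cases c with ⟨hc, hc'⟩ | ⟨hc, hc'⟩ <;>
    rw [ha, hb] at hba <;> rw [hb, hc] at hcb <;> rw [ha, hc] <;>
    simp only [abs_le]
  · right; right; left; constructor <;> linarith
  · left; constructor <;> linarith
  · right; left; constructor <;> linarith
  · left; constructor <;> linarith
  · left; constructor <;> linarith
  · right; left; constructor <;> linarith
  · left; constructor <;> linarith
  · right; right; left; constructor <;> linarith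

lemma jap_prod_le {r ρ η a b c ξ : ℝ} (hr : 0 ≤ r) (hρ : 0 ≤ ρ) (hη : 0 < η)
    (hsum : 6 * r + ρ + 6 * η ≤ 1) (hξ : a + b + c = ξ) (hcb : |c| ≤ |b|) (hba : |b| ≤ |a|)
    (hb : b ∉ ({ξ, -ξ, ξ / 3, -ξ / 3} : Set ℝ)) :
    jap (2 * r) a * jap (2 * r) b * jap (2 * r) c ≤
      (16 * 9 ^ (ρ / 2)) * jap (-ρ) ξ * (resWeight η ξ b *
        (|a ^ 2 - c ^ 2| + jap (-2) (a - c))) := by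
  have hη1 : η < 1 := by linarith
  have hp : ∀ z : ℝ, 0 ≤ jap (-(3 * η)) b * |b - z| ^ (-(1 - η)) := fun z =>
    mul_nonneg (jap_nonneg _ _) (by positivity)
  simp only [mem_insert_iff, mem_singleton_iff, not_or] at hb
  obtain ⟨z, hz, hzD, hzW⟩ : ∃ z, b ≠ z ∧ |b - z| ≤ |a| - |c| ∧
      jap (-(3 * η)) b * |b - z| ^ (-(1 - η)) ≤ resWeight η ξ b := by
    have h1 := hp ξ
    have h2 := hp (-ξ)
    have h3 := hp (ξ / 3)
    have h4 := hp (-ξ / 3)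
    unfold resWeight
    rcases exists_abs_sub_le hξ hcb hba with h | h | h | h
    · exact ⟨_, hb.1, h, by linarith⟩
    · exact ⟨_, hb.2.1, h, by linarith⟩
    · exact ⟨_, hb.2.2.1, h, by linarith⟩
    · exact ⟨_, hb.2.2.2, h, by linarith⟩
  have hz0 : 0 < |b - z| := abs_pos.2 (sub_ne_zero.2 hz)
  have hD : 0 < |a| - |c| := hz0.trans_le hzD
  have hW : jap (-(3 * η)) a * (|a| - |c|) ^ (-(1 - η)) ≤ resWeight η ξ b := by
    refine le_trans ?_ hzW
    have h1 := jap_neg_le_of_le (s := 3 * η) (c := 1) (x := b) (y := a) (by linarith) zero_le_one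
      (by nlinarith [sq_abs a, sq_abs b, abs_nonneg a, abs_nonneg b])
    rw [Real.one_rpow, one_mul] at h1
    have h2 := Real.rpow_le_rpow_of_nonpos hz0 hzD (by linarith : -(1 - η) ≤ 0)
    exact mul_le_mul h1 h2 (by positivity) (jap_nonneg _ _)
  have habs : ∀ x : ℝ, |x| ≤ |a| → jap (2 * r) x ≤ jap (2 * r) a := fun x hx => by
    have := jap_le_of_le (s := 2 * r) (c := 1) (x := x) (y := a) (by linarith) zero_le_one
      (by nlinarith [sq_abs a, sq_abs x, abs_nonneg a, abs_nonneg x])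
    rwa [Real.one_rpow, one_mul] at this
  have hξa : jap (-ρ) a ≤ 9 ^ (ρ / 2) * jap (-ρ) ξ := by
    refine jap_neg_le_of_le hρ (by norm_num) ?_
    have : |ξ| ≤ 3 * |a| := by
      rw [← hξ]
      linarith [abs_add_three a b c]
    nlinarith [sq_abs a, sq_abs ξ, abs_nonneg a, abs_nonneg ξ]
  have hac : jap (-2) a ≤ 4 * jap (-2) (a - c) := by
    have := jap_neg_le_of_le (s := 2) (c := 4) (x := a - c) (y := a) (by norm_num) (by norm_num) (by
      have : |a - c| ≤ 2 * |a| := by linarith [abs_sub a c]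
      nlinarith [sq_abs a, sq_abs (a - c), abs_nonneg a, abs_nonneg (a - c)])
    simpa using this
  have hcore := jap_mul_rpow_le hη hη1 (by linarith : |c| < |a|)
  have hDD : (|a| - |c|) ^ (1 - η) * (|a| - |c|) ^ (-(1 - η)) = 1 := by
    rw [← Real.rpow_add hD, add_neg_cancel, Real.rpow_zero]
  have hX : |a ^ 2 - c ^ 2| + jap (-2) a ≤ 4 * (|a ^ 2 - c ^ 2| + jap (-2) (a - c)) := by
    linarith [abs_nonneg (a ^ 2 - c ^ 2)]
  have hX0 : 0 ≤ |a ^ 2 - c ^ 2| + jap (-2) (a - c) :=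
    add_nonneg (abs_nonneg _) (jap_nonneg _ _)
  calc jap (2 * r) a * jap (2 * r) b * jap (2 * r) c
      ≤ jap (2 * r) a * jap (2 * r) a * jap (2 * r) a := by
        have := jap_nonneg (2 * r) a
        have := jap_nonneg (2 * r) b
        have := jap_nonneg (2 * r) c
        gcongr
        · exact habs b hba
        · exact habs c (hcb.trans hba)
    _ = jap (6 * r) a := by rw [← jap_add, ← jap_add]; congr 1; ring
    _ ≤ jap (-ρ + -(3 * η) + (1 - 3 * η)) a := jap_mono_left (by linarith) a
    _ = jap (-ρ) a * (jap (-(3 * η)) a * (|a| - |c|) ^ (-(1 - η))) *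
        (jap (1 - 3 * η) a * (|a| - |c|) ^ (1 - η)) := by
      rw [jap_add, jap_add]
      linear_combination (-(jap (-ρ) a * jap (-(3 * η)) a * jap (1 - 3 * η) a)) * hDD
    _ ≤ (9 ^ (ρ / 2) * jap (-ρ) ξ) * resWeight η ξ b *
        (4 * (4 * (|a ^ 2 - c ^ 2| + jap (-2) (a - c)))) := by
      have := jap_nonneg (-ρ) a
      have := jap_nonneg (-ρ) ξ
      have := jap_nonneg (-(3 * η)) a
      have := jap_nonneg (1 - 3 * η) a
      have := resWeight_nonneg η ξ b
      exact mul_le_mul (mul_le_mul hξa hW (by positivity) (by positivity))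
        (hcore.trans (by linarith)) (by positivity) (by positivity)
    _ = _ := by ring

lemma exists_lintegral_phase_add_le {r : ℝ} (hr : 1 < r) :
    ∃ C : ℝ≥0, ∀ e T : ℝ, ∫⁻ x, ENNReal.ofReal ((|x ^ 2 - (e - x) ^ 2| +
      jap (-2) (x - (e - x))) * jap (-r) (T - x ^ 3 - (e - x) ^ 3)) ≤ C := by
  obtain ⟨C₁, h₁⟩ := exists_lintegral_phase_le hr
  obtain ⟨C₂, h₂⟩ := exists_lintegral_jap_le one_lt_two
  refine ⟨C₁ + C₂, fun e T => ?_⟩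
  calc _ ≤ ∫⁻ x, (ENNReal.ofReal (|x ^ 2 - (e - x) ^ 2| * jap (-r) (T - x ^ 3 - (e - x) ^ 3)) +
        ENNReal.ofReal (jap (-2) (x - e / 2))) := by
        refine lintegral_mono fun x => ?_
        rw [← ENNReal.ofReal_add (mul_nonneg (abs_nonneg _) (jap_nonneg _ _)) (jap_nonneg _ _),
          add_mul]
        have h3 := jap_neg_le_of_le (s := 2) (c := 1) (x := x - e / 2) (y := x - (e - x))
          (by norm_num) zero_le_one (by nlinarith [sq_nonneg (x - e / 2)])
        rw [Real.one_rpow, one_mul] at h3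
        gcongr
        exact (mul_le_of_le_one_right (jap_nonneg _ _) (jap_le_one (by linarith) _)).trans h3
    _ ≤ _ := by
        rw [lintegral_add_left (by fun_prop)]
        push_cast
        exact add_le_add (h₁ e T) (h₂ _)

/-- The resonant kernel attached to the frequency `b` of intermediate size. -/
def resKernel (η r ξ T b a : ℝ) : ℝ :=
  resWeight η ξ b * ((|a ^ 2 - (ξ - b - a) ^ 2| + jap (-2) (a - (ξ - b - a))) *
    jap (-r) (T - b ^ 3 - a ^ 3 - (ξ - b - a) ^ 3))

lemma resKernel_nonneg (η r ξ T b a : ℝ) : 0 ≤ resKernel η r ξ T b a :=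
  mul_nonneg (resWeight_nonneg _ _ _)
    (mul_nonneg (add_nonneg (abs_nonneg _) (jap_nonneg _ _)) (jap_nonneg _ _))

lemma resKernel_symm (η r ξ T b a : ℝ) :
    resKernel η r ξ T b (ξ - b - a) = resKernel η r ξ T b a := by
  unfold resKernel
  rw [← jap_neg (-2), abs_sub_comm]
  ring_nf

@[fun_prop]
lemma measurable_resKernel {α : Type*} [MeasurableSpace α] (η r ξ T : ℝ) {f g : α → ℝ}
    (hf : Measurable f) (hg : Measurable g) :
    Measurable fun x => resKernel η r ξ T (f x) (g x) := by
  unfold resKernel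
  fun_prop

lemma exists_lintegral_resKernel_le {η r : ℝ} (h0 : 0 < η) (h1 : η < 1) (hr : 1 < r) :
    ∃ C : ℝ≥0, ∀ ξ T, ∫⁻ b, ∫⁻ a, ENNReal.ofReal (resKernel η r ξ T b a) ≤ C := by
  obtain ⟨C₁, h₁⟩ := exists_lintegral_resWeight_le h0 h1
  obtain ⟨C₂, h₂⟩ := exists_lintegral_phase_add_le hr
  refine ⟨C₁ * C₂, fun ξ T => ?_⟩
  calc _ ≤ ∫⁻ b, ENNReal.ofReal (resWeight η ξ b) * C₂ := by
        refine lintegral_mono fun b => ?_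
        simp only [resKernel, ENNReal.ofReal_mul (resWeight_nonneg η ξ b)]
        rw [lintegral_const_mul _ (by fun_prop)]
        gcongr
        exact h₂ (ξ - b) (T - b ^ 3)
    _ ≤ _ := by
        rw [lintegral_mul_const _ (by fun_prop)]
        push_cast
        gcongr
        exact h₁ ξ

lemma jap_prod_mul_le {r ρ η r' ξ T x y z : ℝ} (hr : 0 ≤ r) (hρ : 0 ≤ ρ) (hη : 0 < η)
    (hsum : 6 * r + ρ + 6 * η ≤ 1) (hxyz : x + y + z = ξ)
    (hx : x ∉ ({ξ, -ξ, ξ / 3, -ξ / 3} : Set ℝ)) (hy : y ∉ ({ξ, -ξ, ξ / 3, -ξ / 3} : Set ℝ))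
    (hz : z ∉ ({ξ, -ξ, ξ / 3, -ξ / 3} : Set ℝ)) :
    jap (2 * r) x * jap (2 * r) y * jap (2 * r) z * jap (-r') (T - x ^ 3 - y ^ 3 - z ^ 3) ≤
      (16 * 9 ^ (ρ / 2)) * jap (-ρ) ξ * (resKernel η r' ξ T x y + resKernel η r' ξ T y x +
        resKernel η r' ξ T z y) := by
  have key : ∀ a b c : ℝ, a + b + c = ξ → a ^ 3 + b ^ 3 + c ^ 3 = x ^ 3 + y ^ 3 + z ^ 3 →
      b ∉ ({ξ, -ξ, ξ / 3, -ξ / 3} : Set ℝ) →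
      |c| ≤ |b| → |b| ≤ |a| →
      jap (2 * r) a * jap (2 * r) b * jap (2 * r) c * jap (-r') (T - x ^ 3 - y ^ 3 - z ^ 3) ≤
        (16 * 9 ^ (ρ / 2)) * jap (-ρ) ξ * resKernel η r' ξ T b a := by
    intro a b c h h' hb hcb hba
    have h1 := mul_le_mul_of_nonneg_right (jap_prod_le hr hρ hη hsum h hcb hba hb)
      (jap_nonneg (-r') (T - x ^ 3 - y ^ 3 - z ^ 3))
    refine h1.trans_eq ?_
    rw [resKernel, show ξ - b - a = c by linarith,
      show T - x ^ 3 - y ^ 3 - z ^ 3 = T - b ^ 3 - a ^ 3 - c ^ 3 by linarith]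
    ring
  have hc : 0 ≤ (16 * 9 ^ (ρ / 2)) * jap (-ρ) ξ := mul_nonneg (by positivity) (jap_nonneg _ _)
  have n1 := mul_nonneg hc (resKernel_nonneg η r' ξ T x y)
  have n2 := mul_nonneg hc (resKernel_nonneg η r' ξ T y x)
  have n3 := mul_nonneg hc (resKernel_nonneg η r' ξ T z y)
  have s1 := resKernel_symm η r' ξ T x y
  have s2 := resKernel_symm η r' ξ T y x
  have s3 := resKernel_symm η r' ξ T z y
  rw [show ξ - x - y = z by linarith] at s1
  rw [show ξ - y - x = z by linarith] at s2
  rw [show ξ - z - y = x by linarith] at s3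
  rw [mul_add, mul_add]
  rcases le_total |x| |y| with h1 | h1 <;> rcases le_total |y| |z| with h2 | h2 <;>
    rcases le_total |x| |z| with h3 | h3
  · linarith [s2 ▸ key z y x (by linarith) (by ring) hy h1 h2]
  · linarith [s2 ▸ key z y x (by linarith) (by ring) hy h1 h2]
  · linarith [key y z x (by linarith) (by ring) hz h3 h2]
  · linarith [key y x z (by linarith) (by ring) hx h3 h1]
  · linarith [s1 ▸ key z x y (by linarith) (by ring) hx h1 h3]
  · linarith [s3 ▸ key x z y (by linarith) (by ring) hz h2 h3]
  · linarith [key x y z (by linarith) (by ring) hy h2 h1]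
  · linarith [key x y z (by linarith) (by ring) hy h2 h1]

lemma exists_lintegral_jap_prod_mul_le {r ρ r' : ℝ} (hr : 0 ≤ r) (hρ : 0 ≤ ρ)
    (hsum : 6 * r + ρ < 1) (hr' : 1 < r') :
    ∃ C : ℝ≥0, ∀ ξ T, ∫⁻ x, ∫⁻ y, ENNReal.ofReal (jap (2 * r) x * jap (2 * r) y *
      jap (2 * r) (ξ - x - y) * jap (-r') (T - x ^ 3 - y ^ 3 - (ξ - x - y) ^ 3)) ≤
        C * ENNReal.ofReal (jap (-ρ) ξ) := by
  set η := (1 - 6 * r - ρ) / 6 with hηdef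
  have hη : 0 < η := by linarith
  obtain ⟨C, hC⟩ := exists_lintegral_resKernel_le hη (by linarith) hr'
  refine ⟨(16 * 9 ^ (ρ / 2) : ℝ).toNNReal * (C + C + C), fun ξ T => ?_⟩
  set R : ℝ → ℝ → ℝ≥0∞ := fun b a => ENNReal.ofReal (resKernel η r' ξ T b a) with hR
  have hbad : ({ξ, -ξ, ξ / 3, -ξ / 3} : Set ℝ).Finite := by simp
  have hnb : ∀ᵐ x : ℝ, x ∉ ({ξ, -ξ, ξ / 3, -ξ / 3} : Set ℝ) :=
    measure_eq_zero_iff_ae_notMem.1 (hbad.measure_zero _)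
  have hnb' : ∀ e : ℝ, ∀ᵐ x : ℝ, e - x ∉ ({ξ, -ξ, ξ / 3, -ξ / 3} : Set ℝ) := fun e =>
    (volume.measurePreserving_sub_left e).quasiMeasurePreserving.ae hnb
  calc _ ≤ ∫⁻ x, ∫⁻ y, ENNReal.ofReal ((16 * 9 ^ (ρ / 2)) * jap (-ρ) ξ) *
        (R x y + R y x + R (ξ - x - y) y) := by
        refine lintegral_mono_ae ?_
        filter_upwards [hnb] with x hx
        refine lintegral_mono_ae ?_
        filter_upwards [hnb, hnb' (ξ - x)] with y hy hz
        simp only [hR]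
        rw [← ENNReal.ofReal_add (resKernel_nonneg _ _ _ _ _ _) (resKernel_nonneg _ _ _ _ _ _),
          ← ENNReal.ofReal_add (add_nonneg (resKernel_nonneg _ _ _ _ _ _)
            (resKernel_nonneg _ _ _ _ _ _)) (resKernel_nonneg _ _ _ _ _ _),
          ← ENNReal.ofReal_mul (mul_nonneg (by positivity) (jap_nonneg _ _))]
        exact ENNReal.ofReal_le_ofReal
          (jap_prod_mul_le hr hρ hη (by linarith) (by ring) hx hy hz)
    _ = ENNReal.ofReal ((16 * 9 ^ (ρ / 2)) * jap (-ρ) ξ) *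
        ((∫⁻ x, ∫⁻ y, R x y) + (∫⁻ x, ∫⁻ y, R y x) + ∫⁻ x, ∫⁻ y, R (ξ - x - y) y) := by
        have hm : ∀ {f g : ℝ × ℝ → ℝ}, Measurable f → Measurable g →
            Measurable fun p => R (f p) (g p) := fun hf hg => by
          simp only [hR]
          fun_prop
        have m1 : Measurable fun p : ℝ × ℝ => R p.1 p.2 := hm (by fun_prop) (by fun_prop)
        have m2 : Measurable fun p : ℝ × ℝ => R p.2 p.1 := hm (by fun_prop) (by fun_prop)
        have m3 : Measurable fun p : ℝ × ℝ => R (ξ - p.1 - p.2) p.2 :=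
          hm (by fun_prop) (by fun_prop)
        rw [lintegral_lintegral (by fun_prop), lintegral_lintegral m1.aemeasurable,
          lintegral_lintegral m2.aemeasurable, lintegral_lintegral m3.aemeasurable,
          lintegral_const_mul _ (by fun_prop), lintegral_add_left (by fun_prop),
          lintegral_add_left (by fun_prop)]
    _ ≤ ENNReal.ofReal ((16 * 9 ^ (ρ / 2)) * jap (-ρ) ξ) * (C + C + C) := by
        have h2 : ∫⁻ x, ∫⁻ y, R y x ≤ C := by
          rw [lintegral_lintegral_swap (by simp only [hR, Function.uncurry_def]; fun_prop)]
          exact hC ξ T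
        gcongr
        · exact hC ξ T
        · rw [lintegral_lintegral_swap (by simp only [hR, Function.uncurry_def]; fun_prop)]
          refine le_trans (le_of_eq ?_) h2
          refine lintegral_congr fun y => ?_
          simp_rw [sub_right_comm ξ _ y]
          exact lintegral_sub_left_eq_self (fun x => R x y) (ξ - y)
    _ = _ := by
        rw [ENNReal.ofReal_mul (by positivity)]
        push_cast
        rw [ENNReal.ofReal]
        ring

/-- The modulation weight `⟨ξ⟩^r ⟨τ - ξ³⟩^(-r')` at the point `p = (τ, ξ)`. -/
def bourgainWeight (r r' : ℝ) (p : ℝ × ℝ) : ℝ := jap r p.2 * jap (-r') (p.1 - p.2 ^ 3)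

lemma bourgainWeight_pos (r r' : ℝ) (p : ℝ × ℝ) : 0 < bourgainWeight r r' p :=
  mul_pos (jap_pos _ _) (jap_pos _ _)

@[fun_prop]
lemma measurable_bourgainWeight (r r' : ℝ) : Measurable (bourgainWeight r r') := by
  unfold bourgainWeight
  fun_prop

lemma exists_lintegral_const_mul_jap_mul_jap_le {r : ℝ} (hr : 1 < r) :
    ∃ C : ℝ≥0, ∀ k x z, 0 ≤ k → ∫⁻ y, ENNReal.ofReal (k * (jap (-r) (y - x) * jap (-r) (z - y))) ≤
      C * ENNReal.ofReal (k * jap (-r) (z - x)) := by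
  obtain ⟨C, hC⟩ := exists_lintegral_jap_mul_jap_le hr
  refine ⟨C, fun k x z hk => ?_⟩
  simp_rw [ENNReal.ofReal_mul hk]
  rw [lintegral_const_mul _ (by fun_prop), mul_left_comm]
  gcongr
  exact hC x z

lemma exists_lintegral_bourgainWeight_le {r ρ r' : ℝ} (hr : 0 ≤ r) (hρ : 0 ≤ ρ)
    (hsum : 6 * r + ρ < 1) (hr' : 1 < r') :
    ∃ C : ℝ≥0, ∀ p : ℝ × ℝ, ∫⁻ q, ∫⁻ q', ENNReal.ofReal (bourgainWeight (2 * r) r' q *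
      bourgainWeight (2 * r) r' q' * bourgainWeight (2 * r) r' (p - q - q')) ≤
        C * ENNReal.ofReal (jap (-ρ) p.2) := by
  obtain ⟨C, hC⟩ := exists_lintegral_jap_prod_mul_le hr hρ hsum hr'
  obtain ⟨D, hD⟩ := exists_lintegral_const_mul_jap_mul_jap_le hr'
  refine ⟨D * (D * C), fun p => ?_⟩
  obtain ⟨J, hJ⟩ : ∃ J : ℝ → ℝ → ℝ, J = fun x y => jap (2 * r) x * jap (2 * r) y *
    jap (2 * r) (p.2 - x - y) := ⟨_, rfl⟩
  have hJ0 : ∀ x y, 0 ≤ J x y := fun x y => by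
    rw [hJ]
    exact mul_nonneg (mul_nonneg (jap_nonneg _ _) (jap_nonneg _ _)) (jap_nonneg _ _)
  have hJm : Measurable fun q : ℝ × ℝ => J q.1 q.2 := by
    simp only [hJ]
    fun_prop
  have hJm' : ∀ x, Measurable fun y => J x y := fun x => by
    simp only [hJ]
    fun_prop
  have h1 : ∀ q : ℝ × ℝ, ∫⁻ q', ENNReal.ofReal (bourgainWeight (2 * r) r' q *
      bourgainWeight (2 * r) r' q' * bourgainWeight (2 * r) r' (p - q - q')) ≤
      D * ∫⁻ y, ENNReal.ofReal (J q.2 y * (jap (-r') (q.1 - q.2 ^ 3) *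
        jap (-r') (p.1 - y ^ 3 - (p.2 - q.2 - y) ^ 3 - q.1))) := by
    intro q
    rw [Measure.volume_eq_prod, lintegral_prod_symm _ (by fun_prop),
      ← lintegral_const_mul' _ _ ENNReal.coe_ne_top]
    refine lintegral_mono fun y => ?_
    have := hD (J q.2 y * jap (-r') (q.1 - q.2 ^ 3)) (y ^ 3)
      (p.1 - q.1 - (p.2 - q.2 - y) ^ 3) (mul_nonneg (hJ0 _ _) (jap_nonneg _ _))
    rw [show p.1 - y ^ 3 - (p.2 - q.2 - y) ^ 3 - q.1 =
      p.1 - q.1 - (p.2 - q.2 - y) ^ 3 - y ^ 3 by ring, ← mul_assoc (J q.2 y)]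
    refine le_trans (le_of_eq (lintegral_congr fun t => ?_)) this
    congr 1
    simp only [bourgainWeight, hJ, Prod.fst_sub, Prod.snd_sub]
    rw [show p.1 - q.1 - t - (p.2 - q.2 - y) ^ 3 = p.1 - q.1 - (p.2 - q.2 - y) ^ 3 - t by ring]
    ring
  refine (lintegral_mono h1).trans ?_
  rw [lintegral_const_mul' _ _ ENNReal.coe_ne_top]
  push_cast
  rw [mul_assoc]
  gcongr
  rw [Measure.volume_eq_prod, lintegral_prod_symm _ (by
    refine (Measurable.lintegral_prod_right ?_).aemeasurable
    have : Measurable fun z : (ℝ × ℝ) × ℝ => J z.1.2 z.2 :=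
      hJm.comp (measurable_fst.snd.prodMk measurable_snd)
    fun_prop), mul_assoc]
  calc _ ≤ ∫⁻ x, ∫⁻ y, D * ENNReal.ofReal (J x y *
        jap (-r') (p.1 - x ^ 3 - y ^ 3 - (p.2 - x - y) ^ 3)) := by
        refine lintegral_mono fun x => ?_
        dsimp only
        rw [lintegral_lintegral_swap (by
          have : Measurable fun z : ℝ × ℝ => J x z.2 := (hJm' x).comp measurable_snd
          simp only [Function.uncurry_def]
          fun_prop)]
        refine lintegral_mono fun y => ?_
        have := hD (J x y) (x ^ 3) (p.1 - y ^ 3 - (p.2 - x - y) ^ 3) (hJ0 _ _)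
        rwa [show p.1 - y ^ 3 - (p.2 - x - y) ^ 3 - x ^ 3 =
          p.1 - x ^ 3 - y ^ 3 - (p.2 - x - y) ^ 3 by ring] at this
    _ ≤ _ := by
        simp_rw [lintegral_const_mul' _ _ (ENNReal.coe_ne_top (r := D))]
        gcongr
        simp only [hJ]
        exact hC p.2 p.1

lemma jap_modulation_le {b' r' ρ : ℝ} (hb' : b' ≤ 0) (hρ : ρ = 3 * (2 * b' + r')) (hρ0 : 0 ≤ ρ)
    (σ ξ : ℝ) :
    jap (2 * b') σ ≤ jap (-r') σ * jap ρ ξ + jap (6 * b') ξ := by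
  have hpos : ∀ x, 0 < jap 1 x := jap_pos 1
  rcases le_total (jap 1 σ) (jap 1 ξ ^ (3 : ℝ)) with h | h
  · refine le_add_of_le_of_nonneg ?_ (jap_nonneg _ _)
    rw [show 2 * b' = -r' + (2 * b' + r') by ring, jap_add]
    gcongr
    · exact jap_nonneg _ _
    · rw [jap_eq_rpow, jap_eq_rpow ρ, hρ, Real.rpow_mul (hpos ξ).le]
      exact Real.rpow_le_rpow (hpos σ).le h (by linarith)
  · refine le_add_of_nonneg_of_le (mul_nonneg (jap_nonneg _ _) (jap_nonneg _ _)) ?_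
    rw [jap_eq_rpow, jap_eq_rpow (6 * b'), show 6 * b' = 3 * (2 * b') by ring,
      Real.rpow_mul (hpos ξ).le]
    exact Real.rpow_le_rpow_of_nonpos (Real.rpow_pos_of_pos (hpos ξ) _) h (by linarith)

/-- The frequencies `x` and `y` have comparatively separated moduli. -/
def Separated (x y : ℝ) : Prop := |x| / 5 ≤ |(|y| - |x|)|

lemma Separated.bounds {x y : ℝ} (h : Separated x y) :
    |x| ≤ 5 * |x - y| ∧ |y| ≤ 6 * |x - y| ∧ |x - y| ≤ 11 * |x + y| := by
  unfold Separated at h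
  have h1 : |(|y| - |x|)| ≤ |x - y| := by
    rw [abs_sub_comm x y]; exact abs_abs_sub_abs_le y x
  have h2 : |(|y| - |x|)| ≤ |x + y| := by
    have := abs_abs_sub_abs_le y (-x)
    rwa [abs_neg, sub_neg_eq_add, add_comm] at this
  have h3 := le_abs_self (|y| - |x|)
  have h4 := abs_sub x y
  refine ⟨by linarith, by linarith, by linarith⟩

lemma measurableSet_separated : MeasurableSet {q : ℝ × ℝ | Separated q.1 q.2} :=
  (isClosed_le (by fun_prop) (by fun_prop)).measurableSet

lemma Separated.mul_jap_le {r x y : ℝ} (hr : 0 ≤ r) (hr' : r ≤ 1) (h : Separated x y) :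
    x ^ 2 * (jap (-(2 * r)) x * jap (2 * r) y) ≤ 36 * jap 2 (x - y) := by
  obtain ⟨h1, h2, -⟩ := h.bounds
  have hx : jap (2 + -(2 * r)) x ≤ 36 ^ ((2 + -(2 * r)) / 2) * jap (2 + -(2 * r)) (x - y) :=
    jap_le_of_le (by linarith) (by norm_num)
      (by nlinarith [sq_abs x, sq_abs (x - y), abs_nonneg x, abs_nonneg (x - y)])
  have hy : jap (2 * r) y ≤ 36 ^ (2 * r / 2) * jap (2 * r) (x - y) :=
    jap_le_of_le (by linarith) (by norm_num)
      (by nlinarith [sq_abs y, sq_abs (x - y), abs_nonneg y, abs_nonneg (x - y)])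
  calc x ^ 2 * (jap (-(2 * r)) x * jap (2 * r) y)
      ≤ jap 2 x * (jap (-(2 * r)) x * jap (2 * r) y) := by
        refine mul_le_mul_of_nonneg_right ?_ (mul_nonneg (jap_nonneg _ _) (jap_nonneg _ _))
        rw [jap_two]
        linarith
    _ = jap (2 + -(2 * r)) x * jap (2 * r) y := by rw [jap_add]; ring
    _ ≤ _ := mul_le_mul hx hy (jap_nonneg _ _) (mul_nonneg (by positivity) (jap_nonneg _ _))
    _ = (36 ^ ((2 + -(2 * r)) / 2) * 36 ^ (2 * r / 2)) *
        (jap (2 + -(2 * r)) (x - y) * jap (2 * r) (x - y)) := by ring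
    _ = _ := by
      rw [← jap_add, ← Real.rpow_add (by norm_num),
        show (2 + -(2 * r)) / 2 + 2 * r / 2 = 1 by ring, Real.rpow_one, add_assoc, neg_add_cancel,
        add_zero]

lemma Separated.jap_two_le {x y : ℝ} (h : Separated x y) :
    jap 2 (x - y) ≤ 22 * |x ^ 2 - y ^ 2| + (Icc (-5 : ℝ) 5).indicator 1 x := by
  obtain ⟨h1, h2, h3⟩ := h.bounds
  have h4 : (x - y) ^ 2 ≤ 11 * |x ^ 2 - y ^ 2| := by
    rw [sq_sub_sq, abs_mul, ← sq_abs]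
    nlinarith [abs_nonneg (x - y)]
  rw [jap_two]
  rcases le_total |x - y| 1 with h5 | h5
  · rw [indicator_of_mem (show x ∈ Icc (-5 : ℝ) 5 from abs_le.1 (by linarith))]
    simp only [Pi.one_apply]
    linarith [abs_nonneg (x ^ 2 - y ^ 2)]
  · have : 0 ≤ (Icc (-5 : ℝ) 5).indicator (1 : ℝ → ℝ) x := indicator_nonneg (by simp) x
    have : 1 ≤ (x - y) ^ 2 := by rw [← sq_abs]; nlinarith
    linarith

/-- The kernel of the outer bilinear estimate, localised to separated frequencies. -/
def sepKernel (r b' r' : ℝ) (p q : ℝ × ℝ) : ℝ :=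
  {z : ℝ × ℝ | Separated z.1 z.2}.indicator 1 (p.2, q.2) *
    (p.2 ^ 2 * (jap (-(2 * r)) p.2 * jap (2 * b') (p.1 - p.2 ^ 3))) * bourgainWeight (2 * r) r' q

@[fun_prop]
lemma measurable_sepKernel {α : Type*} [MeasurableSpace α] (r b' r' : ℝ) {f g : α → ℝ × ℝ}
    (hf : Measurable f) (hg : Measurable g) :
    Measurable fun x => sepKernel r b' r' (f x) (g x) := by
  have : Measurable fun x => {z : ℝ × ℝ | Separated z.1 z.2}.indicator (1 : ℝ × ℝ → ℝ)
      ((f x).2, (g x).2) :=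
    (measurable_one.indicator measurableSet_separated).comp (by fun_prop)
  unfold sepKernel
  fun_prop

lemma sepKernel_le {r b' r' ρ : ℝ} (hr : 0 ≤ r) (hr1 : r ≤ 1) (hb' : b' ≤ 0)
    (hρ : ρ = 3 * (2 * b' + r')) (hρ0 : 0 ≤ ρ) (p q : ℝ × ℝ) :
    sepKernel r b' r' p q ≤ 36 * jap ρ (p.2 - q.2) * ((22 * |p.2 ^ 2 - q.2 ^ 2| +
      (Icc (-5 : ℝ) 5).indicator 1 p.2) * (jap (-r') (p.1 - p.2 ^ 3) *
        jap (-r') (q.1 - q.2 ^ 3))) + 36 * jap (2 + 6 * b') (p.2 - q.2) *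
      ((Icc (-(5 * |p.2 - q.2|)) (5 * |p.2 - q.2|)).indicator 1 p.2 *
        jap (-r') (q.1 - q.2 ^ 3)) := by
  have i1 : 0 ≤ (Icc (-5 : ℝ) 5).indicator (1 : ℝ → ℝ) p.2 := indicator_nonneg (by simp) _
  have i2 : 0 ≤ (Icc (-(5 * |p.2 - q.2|)) (5 * |p.2 - q.2|)).indicator (1 : ℝ → ℝ) p.2 :=
    indicator_nonneg (by simp) _
  have j1 := jap_nonneg ρ (p.2 - q.2)
  have j2 := jap_nonneg (2 + 6 * b') (p.2 - q.2)
  have j3 := jap_nonneg (-r') (p.1 - p.2 ^ 3)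
  have j4 := jap_nonneg (-r') (q.1 - q.2 ^ 3)
  have j5 := jap_nonneg (6 * b') (p.2 - q.2)
  by_cases h : Separated p.2 q.2
  · have h1 := h.mul_jap_le hr hr1
    have h2 := h.jap_two_le
    have h3 := jap_modulation_le hb' hρ hρ0 (p.1 - p.2 ^ 3) (p.2 - q.2)
    rw [sepKernel, indicator_of_mem (show (p.2, q.2) ∈ {z : ℝ × ℝ | Separated z.1 z.2} from h),
      indicator_of_mem (show p.2 ∈ Icc (-(5 * |p.2 - q.2|)) (5 * |p.2 - q.2|) from
        abs_le.1 h.bounds.1), bourgainWeight, jap_add 2]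
    simp only [Pi.one_apply, one_mul]
    have h4 := mul_le_mul h1 h3 (jap_nonneg _ _)
      (mul_nonneg (by norm_num) (jap_nonneg 2 (p.2 - q.2)))
    have h5 := mul_le_mul_of_nonneg_right h4 j4
    have h6 : 36 * (jap ρ (p.2 - q.2) * (jap 2 (p.2 - q.2) * (jap (-r') (p.1 - p.2 ^ 3) *
        jap (-r') (q.1 - q.2 ^ 3)))) ≤ 36 * (jap ρ (p.2 - q.2) * ((22 * |p.2 ^ 2 - q.2 ^ 2| +
      (Icc (-5 : ℝ) 5).indicator 1 p.2) * (jap (-r') (p.1 - p.2 ^ 3) *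
        jap (-r') (q.1 - q.2 ^ 3)))) := by gcongr
    linarith
  · rw [sepKernel, indicator_of_notMem (show (p.2, q.2) ∉ {z : ℝ × ℝ | Separated z.1 z.2} from h)]
    simp only [zero_mul]
    positivity

lemma exists_lintegral_sepKernel_le {r b' r' ρ : ℝ} (hr : 0 ≤ r) (hr1 : r ≤ 1) (hb' : b' ≤ 0)
    (hρ : ρ = 3 * (2 * b' + r')) (hρ0 : 0 ≤ ρ) (hr' : 1 < r') :
    ∃ C : ℝ≥0, ∀ p : ℝ × ℝ, ∫⁻ q, ENNReal.ofReal (sepKernel r b' r' q (q - p)) ≤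
      C * ENNReal.ofReal (jap ρ p.2) := by
  obtain ⟨A, hA⟩ := exists_lintegral_jap_le hr'
  obtain ⟨D, hD⟩ := exists_lintegral_const_mul_jap_mul_jap_le hr'
  obtain ⟨P, hP⟩ := exists_lintegral_phase_le hr'
  refine ⟨36 * (D * (22 * P + 10)) + 36 * (10 * A), fun p => ?_⟩
  obtain ⟨τ, ξ⟩ := p
  dsimp only
  have i1 : ∀ x, 0 ≤ (Icc (-5 : ℝ) 5).indicator (1 : ℝ → ℝ) x := indicator_nonneg (by simp)
  have i2 : ∀ x, 0 ≤ (Icc (-(5 * |ξ|)) (5 * |ξ|)).indicator (1 : ℝ → ℝ) x :=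
    indicator_nonneg (by simp)
  have m1 : Measurable ((Icc (-5 : ℝ) 5).indicator (1 : ℝ → ℝ)) :=
    measurable_one.indicator measurableSet_Icc
  have m2 : Measurable ((Icc (-(5 * |ξ|)) (5 * |ξ|)).indicator (1 : ℝ → ℝ)) :=
    measurable_one.indicator measurableSet_Icc
  have k1 := jap_nonneg ρ ξ
  have k2 := jap_nonneg (2 + 6 * b') ξ
  have hI : ∀ c : ℝ, 0 ≤ c → ∫⁻ x, ENNReal.ofReal ((Icc (-c) c).indicator (1 : ℝ → ℝ) x) =
      ENNReal.ofReal (2 * c) := by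
    intro c hc
    have : ∀ x, ENNReal.ofReal ((Icc (-c) c).indicator (1 : ℝ → ℝ) x) =
        (Icc (-c) c).indicator 1 x := fun x => by
      by_cases hx : x ∈ Icc (-c) c <;> simp [hx]
    simp_rw [this]
    rw [lintegral_indicator_one measurableSet_Icc, Real.volume_Icc]
    congr 1
    ring
  have hpt : ∀ t x : ℝ, ENNReal.ofReal (sepKernel r b' r' (t, x) ((t, x) - (τ, ξ))) ≤
      ENNReal.ofReal (36 * jap ρ ξ) * ENNReal.ofReal ((22 * |x ^ 2 - (ξ - x) ^ 2| +
        (Icc (-5 : ℝ) 5).indicator 1 x) * (jap (-r') (t - x ^ 3) *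
          jap (-r') (τ - (ξ - x) ^ 3 - t))) +
      ENNReal.ofReal (36 * jap (2 + 6 * b') ξ) *
        (ENNReal.ofReal ((Icc (-(5 * |ξ|)) (5 * |ξ|)).indicator 1 x) *
          ENNReal.ofReal (jap (-r') (t - (τ - (ξ - x) ^ 3)))) := by
    intro t x
    have h := sepKernel_le hr hr1 hb' hρ hρ0 (t, x) ((t, x) - (τ, ξ))
    simp only [Prod.mk_sub_mk, sub_sub_cancel] at h ⊢
    rw [show (x - ξ) ^ 2 = (ξ - x) ^ 2 by ring,
      show t - τ - (x - ξ) ^ 3 = t - (τ - (ξ - x) ^ 3) by ring] at h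
    rw [← ENNReal.ofReal_mul (i2 x), ← ENNReal.ofReal_mul (by positivity),
      ← ENNReal.ofReal_mul (by positivity), ← ENNReal.ofReal_add]
    · refine ENNReal.ofReal_le_ofReal (h.trans_eq ?_)
      rw [← jap_neg (-r') (τ - (ξ - x) ^ 3 - t), neg_sub]
    · have := jap_nonneg (-r') (t - x ^ 3)
      have := jap_nonneg (-r') (τ - (ξ - x) ^ 3 - t)
      have := i1 x
      positivity
    · have := jap_nonneg (-r') (t - (τ - (ξ - x) ^ 3))
      have := i2 x
      positivity
  rw [Measure.volume_eq_prod, lintegral_prod_symm _ (by fun_prop)]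
  calc _ ≤ ∫⁻ x, (ENNReal.ofReal (36 * jap ρ ξ) * (D * (22 * ENNReal.ofReal
        (|x ^ 2 - (ξ - x) ^ 2| * jap (-r') (τ - x ^ 3 - (ξ - x) ^ 3)) +
          ENNReal.ofReal ((Icc (-5 : ℝ) 5).indicator 1 x))) +
      ENNReal.ofReal (36 * jap (2 + 6 * b') ξ) *
        (ENNReal.ofReal ((Icc (-(5 * |ξ|)) (5 * |ξ|)).indicator 1 x) * A)) := by
        refine lintegral_mono fun x => (lintegral_mono fun t => hpt t x).trans ?_
        rw [lintegral_add_left (by fun_prop), lintegral_const_mul _ (by fun_prop),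
          lintegral_const_mul _ (by fun_prop), lintegral_const_mul _ (by fun_prop)]
        gcongr
        · refine (hD _ _ _ (add_nonneg (by positivity) (i1 x))).trans ?_
          gcongr
          rw [show τ - (ξ - x) ^ 3 - x ^ 3 = τ - x ^ 3 - (ξ - x) ^ 3 by ring,
            ← ENNReal.ofReal_ofNat 22, ← ENNReal.ofReal_mul (by norm_num),
            ← ENNReal.ofReal_add (mul_nonneg (by norm_num)
              (mul_nonneg (abs_nonneg _) (jap_nonneg _ _))) (i1 x), add_mul]
          refine ENNReal.ofReal_le_ofReal (add_le_add (by rw [mul_assoc]) ?_)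
          exact mul_le_of_le_one_right (i1 x) (jap_le_one (by linarith) _)
        · exact hA _
    _ ≤ ENNReal.ofReal (36 * jap ρ ξ) * (D * (22 * P + ENNReal.ofReal (2 * 5))) +
      ENNReal.ofReal (36 * jap (2 + 6 * b') ξ) * (ENNReal.ofReal (2 * (5 * |ξ|)) * A) := by
        rw [lintegral_add_left (by fun_prop), lintegral_const_mul _ (by fun_prop),
          lintegral_const_mul _ (by fun_prop), lintegral_add_left (by fun_prop),
          lintegral_const_mul _ (by fun_prop), lintegral_const_mul _ (by fun_prop),
          lintegral_mul_const _ (by fun_prop), hI 5 (by norm_num), hI _ (by positivity)]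
        gcongr
        exact hP ξ τ
    _ ≤ ENNReal.ofReal (36 * jap ρ ξ) * (D * (22 * P + ENNReal.ofReal (2 * 5))) +
      ENNReal.ofReal (36 * (10 * jap ρ ξ)) * A := by
        rw [← mul_assoc (ENNReal.ofReal _) _ (A : ℝ≥0∞), ← ENNReal.ofReal_mul (by positivity)]
        gcongr _ + ENNReal.ofReal ?_ * _
        have h1 : |ξ| ≤ jap 1 ξ := by
          refine le_of_sq_le_sq ?_ (jap_nonneg _ _)
          rw [jap_sq, mul_one, jap_two, sq_abs]
          linarith
        have h2 : jap (2 + 6 * b') ξ * jap 1 ξ ≤ jap ρ ξ := by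
          rw [← jap_add]
          exact jap_mono_left (by linarith) ξ
        nlinarith [mul_le_mul_of_nonneg_left h1 k2]
    _ = _ := by
        rw [show (2 * 5 : ℝ) = 10 by norm_num, ENNReal.ofReal_mul (by norm_num),
          ENNReal.ofReal_mul (by norm_num), ENNReal.ofReal_mul (by norm_num)]
        simp only [ENNReal.ofReal_ofNat]
        push_cast
        ring

lemma sq_lintegral_mul_le {α : Type*} [MeasurableSpace α] (μ : Measure α) {f g : α → ℝ≥0∞}
    (hf : AEMeasurable f μ) (hg : AEMeasurable g μ) :
    (∫⁻ a, f a * g a ∂μ) ^ 2 ≤ (∫⁻ a, f a ^ 2 ∂μ) * ∫⁻ a, g a ^ 2 ∂μ := by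
  have h := ENNReal.lintegral_mul_le_Lp_mul_Lq μ Real.HolderConjugate.two_two hf hg
  simp only [Pi.mul_apply, ENNReal.rpow_two] at h
  refine (pow_le_pow_left' h 2).trans_eq ?_
  rw [mul_pow, ← ENNReal.rpow_two, ← ENNReal.rpow_two, ← ENNReal.rpow_mul, ← ENNReal.rpow_mul]
  norm_num

lemma ennreal_add_sq_le (a b : ℝ≥0∞) : (a + b) ^ 2 ≤ 4 * (a ^ 2 + b ^ 2) := by
  have key : ∀ a b : ℝ≥0∞, a ≤ b → (a + b) ^ 2 ≤ 4 * (a ^ 2 + b ^ 2) := fun a b h =>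
    calc (a + b) ^ 2 ≤ (b + b) ^ 2 := by gcongr
      _ = 4 * b ^ 2 := by ring
      _ ≤ _ := by gcongr; exact le_add_self
  rcases le_total a b with h | h
  · exact key a b h
  · rw [add_comm a b, add_comm (a ^ 2)]
    exact key b a h

section lconvolution

variable {f g h : ℝ × ℝ → ℝ≥0∞}

lemma lconvolution_apply (f g : ℝ × ℝ → ℝ≥0∞) (p : ℝ × ℝ) :
    (f ⋆ₗ g) p = ∫⁻ q, f q * g (p - q) := by
  simp only [lconvolution_def, sub_eq_neg_add]

lemma lconvolution_left_comm (hf : Measurable f) (hg : Measurable g) (hh : Measurable h) :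
    f ⋆ₗ (g ⋆ₗ h) = g ⋆ₗ (f ⋆ₗ h) := by
  rw [lconvolution_assoc hf hg hh, lconvolution_comm (f := f), ← lconvolution_assoc hg hf hh]

lemma lintegral_lconvolution (hf : Measurable f) (hg : Measurable g) :
    ∫⁻ p, (f ⋆ₗ g) p = (∫⁻ p, f p) * ∫⁻ p, g p := by
  simp_rw [lconvolution_apply]
  rw [lintegral_lintegral_swap (by simp only [Function.uncurry_def]; fun_prop)]
  rw [← lintegral_mul_const _ hf]
  refine lintegral_congr fun q => ?_
  rw [lintegral_const_mul _ (by fun_prop), lintegral_sub_right_eq_self g q]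

lemma lconvolution_lconvolution_apply (hg : Measurable g) (hh : Measurable h)
    (p : ℝ × ℝ) : (f ⋆ₗ (g ⋆ₗ h)) p = ∫⁻ q, ∫⁻ q', f q * g q' * h (p - q - q') := by
  simp_rw [lconvolution_apply]
  refine lintegral_congr fun q => ?_
  rw [← lintegral_const_mul _ (by fun_prop)]
  simp_rw [mul_assoc]

/-- Cauchy–Schwarz for a weighted triple convolution. -/
lemma sq_lconvolution_mul_le {w : ℝ × ℝ → ℝ≥0∞} (hw : Measurable w) (hf : Measurable f)
    (hg : Measurable g) (hh : Measurable h) (p : ℝ × ℝ) :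
    (((w * f) ⋆ₗ ((w * g) ⋆ₗ (w * h))) p) ^ 2 ≤
      (∫⁻ q, ∫⁻ q', (w q * w q' * w (p - q - q')) ^ 2) *
        ((f ^ 2) ⋆ₗ ((g ^ 2) ⋆ₗ (h ^ 2))) p := by
  rw [lconvolution_lconvolution_apply (by fun_prop) (by fun_prop),
    lconvolution_lconvolution_apply (f := f ^ 2) (g := g ^ 2) (h := h ^ 2) (hg.pow_const 2)
      (hh.pow_const 2)]
  simp only [Pi.mul_apply, Pi.pow_apply]
  rw [lintegral_lintegral (by fun_prop), lintegral_lintegral (by fun_prop),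
    lintegral_lintegral (by fun_prop)]
  have h1 := sq_lintegral_mul_le ((volume : Measure (ℝ × ℝ)).prod (volume : Measure (ℝ × ℝ)))
    (f := fun z => w z.1 * w z.2 * w (p - z.1 - z.2))
    (g := fun z => f z.1 * g z.2 * h (p - z.1 - z.2)) (by fun_prop) (by fun_prop)
  refine le_trans (le_of_eq ?_) (h1.trans_eq ?_)
  · congr 1
    exact lintegral_congr fun z => by ring
  · congr 1
    exact lintegral_congr fun z => by ring

end lconvolution

/-- The `L²` weight carried by each of the four factors. -/
def inWeight (r b : ℝ) (p : ℝ × ℝ) : ℝ≥0∞ := ENNReal.ofReal (bourgainWeight r b p)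

@[fun_prop]
lemma measurable_inWeight (r b : ℝ) : Measurable (inWeight r b) := by
  unfold inWeight
  fun_prop

lemma inWeight_sq (r b : ℝ) (p : ℝ × ℝ) :
    inWeight r b p ^ 2 = ENNReal.ofReal (bourgainWeight (2 * r) (2 * b) p) := by
  rw [inWeight, ← ENNReal.ofReal_pow (bourgainWeight_pos _ _ _).le]
  congr 1
  rw [bourgainWeight, bourgainWeight, mul_pow, jap_sq, jap_sq, mul_neg]

/-- The `L²` weight carried by the derivative of the product. -/
def outWeight (r b' : ℝ) (p : ℝ × ℝ) : ℝ≥0∞ :=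
  ENNReal.ofReal (|p.2| * (jap (-r) p.2 * jap b' (p.1 - p.2 ^ 3)))

@[fun_prop]
lemma measurable_outWeight (r b : ℝ) : Measurable (outWeight r b) := by
  unfold outWeight
  fun_prop

/-- The indicator of the frequencies separated from the frequency of `p`. -/
def sepInd (p q : ℝ × ℝ) : ℝ≥0∞ := {z : ℝ × ℝ | Separated z.1 z.2}.indicator 1 (p.2, q.2)

@[fun_prop]
lemma measurable_sepInd {α : Type*} [MeasurableSpace α] {f g : α → ℝ × ℝ}
    (hf : Measurable f) (hg : Measurable g) : Measurable fun x => sepInd (f x) (g x) :=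
  (measurable_one.indicator measurableSet_separated).comp (f := fun x => ((f x).2, (g x).2))
    (by fun_prop)

lemma ofReal_sepKernel (r b b' : ℝ) (p q : ℝ × ℝ) :
    ENNReal.ofReal (sepKernel r b' (2 * b) p q) =
      (outWeight r b' p * (sepInd p q * inWeight r b q)) ^ 2 := by
  rw [mul_pow, mul_pow, inWeight_sq, sepKernel, sepInd, outWeight]
  by_cases h : (p.2, q.2) ∈ {z : ℝ × ℝ | Separated z.1 z.2}
  · rw [indicator_of_mem h, indicator_of_mem h]
    have h1 : 0 ≤ jap (-r) p.2 * jap b' (p.1 - p.2 ^ 3) :=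
      mul_nonneg (jap_nonneg _ _) (jap_nonneg _ _)
    rw [← ENNReal.ofReal_pow (by positivity), mul_pow, sq_abs, mul_pow, jap_sq, jap_sq, mul_neg]
    simp only [Pi.one_apply, one_mul, one_pow]
    rw [ENNReal.ofReal_mul]
    exact mul_nonneg (sq_nonneg _) (mul_nonneg (jap_nonneg _ _) (jap_nonneg _ _))
  · rw [indicator_of_notMem h, indicator_of_notMem h]
    simp

lemma one_le_sepInd (p q₁ q₂ q₃ q₄ : ℝ × ℝ) (h : q₁ + q₂ + q₃ + q₄ = p) :
    1 ≤ sepInd p q₁ + sepInd p q₂ + sepInd p q₃ + sepInd p q₄ := by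
  have key : ∀ q : ℝ × ℝ, Separated p.2 q.2 → sepInd p q = 1 := fun q hq => by
    rw [sepInd, indicator_of_mem (show (p.2, q.2) ∈ {z : ℝ × ℝ | Separated z.1 z.2} from hq)]
    rfl
  have hp : p.2 = q₁.2 + q₂.2 + q₃.2 + q₄.2 := by rw [← h]; rfl
  by_cases h1 : Separated p.2 q₁.2
  · rw [key _ h1, add_assoc, add_assoc]
    exact le_self_add
  by_cases h2 : Separated p.2 q₂.2
  · rw [key _ h2, add_comm (sepInd p q₁), add_assoc, add_assoc]
    exact le_self_add
  by_cases h3 : Separated p.2 q₃.2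
  · rw [key _ h3, add_right_comm]
    exact le_add_self
  by_cases h4 : Separated p.2 q₄.2
  · rw [key _ h4]
    exact le_add_self
  exfalso
  unfold Separated at h1 h2 h3 h4
  rw [not_le] at h1 h2 h3 h4
  have k : ∀ x y : ℝ, |(|y| - |x|)| < |x| / 5 → |y - x| < |x| / 5 ∨ |y + x| < |x| / 5 := by
    intro x y hxy
    rw [abs_lt] at hxy
    rcases abs_cases x with ⟨e, _⟩ | ⟨e, _⟩ <;> rcases abs_cases y with ⟨e', _⟩ | ⟨e', _⟩ <;>
      rw [e, e'] at hxy <;> rw [e, abs_lt, abs_lt]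
    · left; constructor <;> linarith
    · right; constructor <;> linarith
    · right; constructor <;> linarith
    · left; constructor <;> linarith
  have g1 := k _ _ h1
  have g2 := k _ _ h2
  have g3 := k _ _ h3
  have g4 := k _ _ h4
  rw [hp] at g1 g2 g3 g4
  simp only [abs_lt] at g1 g2 g3 g4
  clear h1 h2 h3 h4 k key
  rcases abs_cases (q₁.2 + q₂.2 + q₃.2 + q₄.2) with ⟨e, _⟩ | ⟨e, _⟩ <;>
    rw [e] at g1 g2 g3 g4 <;>
    rcases g1 with g1 | g1 <;> rcases g2 with g2 | g2 <;> rcases g3 with g3 | g3 <;>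
    rcases g4 with g4 | g4 <;> linarith [g1.1, g1.2, g2.1, g2.2, g3.1, g3.2, g4.1, g4.2]

lemma exists_lintegral_sq_sep_le {r b b' : ℝ} (hr : 0 ≤ r) (hb : 1 / 2 < b) (hb' : b' ≤ 0)
    (hbb' : 0 ≤ b + b') (hsum : r + (b + b') < 1 / 6) :
    ∃ C : ℝ≥0, ∀ f₁ f₂ f₃ f₄ : ℝ × ℝ → ℝ≥0∞, Measurable f₁ → Measurable f₂ → Measurable f₃ →
      Measurable f₄ → ∫⁻ p, (outWeight r b' p * ((sepInd p * (inWeight r b * f₁)) ⋆ₗ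
        ((inWeight r b * f₂) ⋆ₗ ((inWeight r b * f₃) ⋆ₗ (inWeight r b * f₄)))) p) ^ 2 ≤
        C * ((∫⁻ p, f₁ p ^ 2) * ((∫⁻ p, f₂ p ^ 2) * ((∫⁻ p, f₃ p ^ 2) * ∫⁻ p, f₄ p ^ 2))) := by
  set ρ := 6 * (b + b') with hρ
  obtain ⟨C₁, h₁⟩ := exists_lintegral_bourgainWeight_le (r := r) (ρ := ρ) (r' := 2 * b) hr
    (by linarith) (by linarith) (by linarith)
  obtain ⟨C₂, h₂⟩ := exists_lintegral_sepKernel_le (r := r) (b' := b') (r' := 2 * b) (ρ := ρ) hr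
    (by linarith) hb' (by linarith) (by linarith) (by linarith)
  refine ⟨C₂ * C₁, fun f₁ f₂ f₃ f₄ m₁ m₂ m₃ m₄ => ?_⟩
  set w := inWeight r b with hw
  have mw : Measurable w := measurable_inWeight r b
  obtain ⟨H, hH⟩ : ∃ H, H = (w * f₂) ⋆ₗ ((w * f₃) ⋆ₗ (w * f₄)) := ⟨_, rfl⟩
  have mH : Measurable H := by
    rw [hH]
    exact measurable_lconvolution _ (by fun_prop)
      (measurable_lconvolution _ (by fun_prop) (by fun_prop))
  set F := (f₂ ^ 2) ⋆ₗ ((f₃ ^ 2) ⋆ₗ (f₄ ^ 2)) with hF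
  have mF' : Measurable ((f₃ ^ 2) ⋆ₗ (f₄ ^ 2)) :=
    measurable_lconvolution _ (m₃.pow_const 2) (m₄.pow_const 2)
  have hH2 : ∀ p, H p ^ 2 ≤ C₁ * ENNReal.ofReal (jap (-ρ) p.2) * F p := by
    intro p
    rw [hH]
    refine (sq_lconvolution_mul_le mw m₂ m₃ m₄ p).trans ?_
    gcongr
    refine le_trans (le_of_eq ?_) (h₁ p)
    refine lintegral_congr fun q => lintegral_congr fun q' => ?_
    rw [mul_pow, mul_pow, hw, inWeight_sq, inWeight_sq, inWeight_sq,
      ← ENNReal.ofReal_mul (bourgainWeight_pos _ _ _).le,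
      ← ENNReal.ofReal_mul (mul_pos (bourgainWeight_pos _ _ _) (bourgainWeight_pos _ _ _)).le]
  have hCS : ∀ p, (outWeight r b' p * ((sepInd p * (w * f₁)) ⋆ₗ H) p) ^ 2 ≤
      (∫⁻ q, f₁ q ^ 2) * ∫⁻ q, ENNReal.ofReal (sepKernel r b' (2 * b) p q) * H (p - q) ^ 2 := by
    intro p
    have h := sq_lintegral_mul_le volume (f := f₁)
      (g := fun q => outWeight r b' p * (sepInd p q * w q) * H (p - q)) (by fun_prop) (by fun_prop)
    simp_rw [ofReal_sepKernel, ← mul_pow]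
    refine le_trans (le_of_eq ?_) h
    rw [lconvolution_apply, ← lintegral_const_mul _ (by
      have : Measurable (sepInd p) := measurable_sepInd (f := fun _ => p) (by fun_prop) (by fun_prop)
      fun_prop)]
    congr 1
    refine lintegral_congr fun q => ?_
    simp only [Pi.mul_apply]
    ring
  calc _ ≤ ∫⁻ p, (∫⁻ q, f₁ q ^ 2) *
        ∫⁻ q, ENNReal.ofReal (sepKernel r b' (2 * b) p q) * H (p - q) ^ 2 := by
        rw [← hH]
        exact lintegral_mono hCS
    _ = (∫⁻ q, f₁ q ^ 2) *
        ∫⁻ p, ∫⁻ q, ENNReal.ofReal (sepKernel r b' (2 * b) p q) * H (p - q) ^ 2 :=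
        lintegral_const_mul _ (by fun_prop)
    _ = (∫⁻ q, f₁ q ^ 2) *
        ∫⁻ q, (∫⁻ p, ENNReal.ofReal (sepKernel r b' (2 * b) p (p - q))) * H q ^ 2 := by
        congr 1
        have : ∀ p, ∫⁻ q, ENNReal.ofReal (sepKernel r b' (2 * b) p q) * H (p - q) ^ 2 =
            ∫⁻ q, ENNReal.ofReal (sepKernel r b' (2 * b) p (p - q)) * H q ^ 2 := fun p => by
          rw [← lintegral_sub_left_eq_self _ p]
          simp_rw [sub_sub_cancel]
        simp_rw [this]
        rw [lintegral_lintegral_swap (by simp only [Function.uncurry_def]; fun_prop)]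
        exact lintegral_congr fun q => lintegral_mul_const _ (by fun_prop)
    _ ≤ (∫⁻ q, f₁ q ^ 2) * ∫⁻ q, C₂ * C₁ * F q := by
        refine mul_le_mul_right (lintegral_mono fun q => ?_) _
        calc _ ≤ C₂ * ENNReal.ofReal (jap ρ q.2) *
              (C₁ * ENNReal.ofReal (jap (-ρ) q.2) * F q) := by
              gcongr
              · exact h₂ q
              · exact hH2 q
          _ = C₂ * C₁ * F q * (ENNReal.ofReal (jap ρ q.2) * ENNReal.ofReal (jap (-ρ) q.2)) := by
              ring
          _ = _ := by
              rw [← ENNReal.ofReal_mul (jap_nonneg _ _), ← jap_add, add_neg_cancel, jap_zero,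
                ENNReal.ofReal_one, mul_one]
    _ = _ := by
        rw [lintegral_const_mul' _ _ (by finiteness), hF,
          lintegral_lconvolution (f := f₂ ^ 2) (m₂.pow_const 2) mF',
          lintegral_lconvolution (f := f₃ ^ 2) (g := f₄ ^ 2) (m₃.pow_const 2) (m₄.pow_const 2)]
        simp only [Pi.pow_apply]
        push_cast
        ring

/-- A fourfold convolution at `p` is controlled by the sum of the convolutions in which one of the
factors is multiplied by `s`, provided that `s` sums to at least one over the frequencies. -/
lemma lconvolution_le_add_of_one_le {s A₁ A₂ A₃ A₄ : ℝ × ℝ → ℝ≥0∞} (p : ℝ × ℝ) (hs : Measurable s)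
    (h₁ : Measurable A₁) (h₂ : Measurable A₂) (h₃ : Measurable A₃) (h₄ : Measurable A₄)
    (h : ∀ q₁ q₂ q₃ q₄, q₁ + q₂ + q₃ + q₄ = p → 1 ≤ s q₁ + s q₂ + s q₃ + s q₄) :
    (A₁ ⋆ₗ (A₂ ⋆ₗ (A₃ ⋆ₗ A₄))) p ≤
      ((s * A₁) ⋆ₗ (A₂ ⋆ₗ (A₃ ⋆ₗ A₄))) p + (A₁ ⋆ₗ ((s * A₂) ⋆ₗ (A₃ ⋆ₗ A₄))) p +
        ((A₁ ⋆ₗ (A₂ ⋆ₗ ((s * A₃) ⋆ₗ A₄))) p + (A₁ ⋆ₗ (A₂ ⋆ₗ (A₃ ⋆ₗ (s * A₄)))) p) := by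
  have inner : ∀ q₁ q₂, (A₃ ⋆ₗ A₄) (p - q₁ - q₂) ≤
      s q₁ * (A₃ ⋆ₗ A₄) (p - q₁ - q₂) + (s q₂ * (A₃ ⋆ₗ A₄) (p - q₁ - q₂) +
        (((s * A₃) ⋆ₗ A₄) (p - q₁ - q₂) + (A₃ ⋆ₗ (s * A₄)) (p - q₁ - q₂))) := by
    intro q₁ q₂
    simp only [lconvolution_apply, Pi.mul_apply]
    rw [← lintegral_const_mul _ (by fun_prop), ← lintegral_const_mul _ (by fun_prop),
      ← lintegral_add_left (by fun_prop), ← lintegral_add_left (by fun_prop),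
      ← lintegral_add_left (by fun_prop)]
    refine lintegral_mono fun q₃ => ?_
    calc A₃ q₃ * A₄ (p - q₁ - q₂ - q₃) = 1 * (A₃ q₃ * A₄ (p - q₁ - q₂ - q₃)) := (one_mul _).symm
      _ ≤ (s q₁ + s q₂ + s q₃ + s (p - q₁ - q₂ - q₃)) * (A₃ q₃ * A₄ (p - q₁ - q₂ - q₃)) := by
        gcongr
        exact h _ _ _ _ (by abel)
      _ = _ := by ring
  have mc : ∀ {f g : ℝ × ℝ → ℝ≥0∞}, Measurable f → Measurable g → Measurable (f ⋆ₗ g) :=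
    fun hf hg => measurable_lconvolution _ hf hg
  have m34 := mc h₃ h₄
  have m34' := mc (hs.mul h₃) h₄
  have m34'' := mc h₃ (hs.mul h₄)
  have middle : ∀ q₁, (A₂ ⋆ₗ (A₃ ⋆ₗ A₄)) (p - q₁) ≤
      s q₁ * (A₂ ⋆ₗ (A₃ ⋆ₗ A₄)) (p - q₁) + (((s * A₂) ⋆ₗ (A₃ ⋆ₗ A₄)) (p - q₁) +
        ((A₂ ⋆ₗ ((s * A₃) ⋆ₗ A₄)) (p - q₁) + (A₂ ⋆ₗ (A₃ ⋆ₗ (s * A₄))) (p - q₁))) := by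
    intro q₁
    rw [lconvolution_apply A₂, lconvolution_apply (s * A₂), lconvolution_apply A₂,
      lconvolution_apply A₂]
    simp only [Pi.mul_apply]
    rw [← lintegral_const_mul _ (by fun_prop),
      ← lintegral_add_left (by fun_prop), ← lintegral_add_left (by fun_prop),
      ← lintegral_add_left (by fun_prop)]
    refine lintegral_mono fun q₂ => ?_
    refine (mul_le_mul_right (inner q₁ q₂) (A₂ q₂)).trans_eq ?_
    ring
  have n1 := mc h₂ m34
  have n2 := mc (hs.mul h₂) m34
  have n3 := mc h₂ m34'
  have n4 := mc h₂ m34''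
  rw [lconvolution_apply A₁, lconvolution_apply (s * A₁), lconvolution_apply A₁,
    lconvolution_apply A₁, lconvolution_apply A₁]
  simp only [Pi.mul_apply]
  rw [← lintegral_add_left (by fun_prop), ← lintegral_add_left (by fun_prop),
    ← lintegral_add_left (by fun_prop)]
  refine lintegral_mono fun q₁ => ?_
  refine (mul_le_mul_right (middle q₁) (A₁ q₁)).trans_eq ?_
  ring

lemma exists_lintegral_sq_lconvolution_le {r b b' : ℝ} (hr : 0 ≤ r) (hb : 1 / 2 < b) (hb' : b' ≤ 0)
    (hbb' : 0 ≤ b + b') (hsum : r + (b + b') < 1 / 6) :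
    ∃ C : ℝ≥0, ∀ f₁ f₂ f₃ f₄ : ℝ × ℝ → ℝ≥0∞, Measurable f₁ → Measurable f₂ → Measurable f₃ →
      Measurable f₄ → ∫⁻ p, (outWeight r b' p * ((inWeight r b * f₁) ⋆ₗ
        ((inWeight r b * f₂) ⋆ₗ ((inWeight r b * f₃) ⋆ₗ (inWeight r b * f₄)))) p) ^ 2 ≤
        C * ((∫⁻ p, f₁ p ^ 2) * ((∫⁻ p, f₂ p ^ 2) * ((∫⁻ p, f₃ p ^ 2) * ∫⁻ p, f₄ p ^ 2))) := by
  obtain ⟨C, hC⟩ := exists_lintegral_sq_sep_le hr hb hb' hbb' hsum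
  refine ⟨64 * C, fun f₁ f₂ f₃ f₄ m₁ m₂ m₃ m₄ => ?_⟩
  set w := inWeight r b with hw
  have mw : Measurable w := measurable_inWeight r b
  have ms : ∀ p, Measurable (sepInd p) := fun p =>
    measurable_sepInd (f := fun _ => p) (by fun_prop) (by fun_prop)
  obtain ⟨Q, hQ⟩ : ∃ Q : (ℝ × ℝ → ℝ≥0∞) → (ℝ × ℝ → ℝ≥0∞) → (ℝ × ℝ → ℝ≥0∞) →
      (ℝ × ℝ → ℝ≥0∞) → ℝ × ℝ → ℝ≥0∞, Q = fun f g h k p => outWeight r b' p *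
        ((sepInd p * (w * f)) ⋆ₗ ((w * g) ⋆ₗ ((w * h) ⋆ₗ (w * k)))) p := ⟨_, rfl⟩
  have mc : ∀ {f g : ℝ × ℝ → ℝ≥0∞}, Measurable f → Measurable g → Measurable (f ⋆ₗ g) :=
    fun hf hg => measurable_lconvolution _ hf hg
  have mQ : ∀ {f g h k : ℝ × ℝ → ℝ≥0∞}, Measurable f → Measurable g → Measurable h →
      Measurable k → Measurable (Q f g h k) := by
    intro f g h k hf hg hh hk
    have m := mc (f := w * g) (by fun_prop)
      (mc (f := w * h) (g := w * k) (by fun_prop) (by fun_prop))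
    simp only [hQ, lconvolution_apply (sepInd _ * _), Pi.mul_apply]
    fun_prop
  have hconv : ∀ p, outWeight r b' p * ((w * f₁) ⋆ₗ ((w * f₂) ⋆ₗ ((w * f₃) ⋆ₗ (w * f₄)))) p ≤
      Q f₁ f₂ f₃ f₄ p + Q f₂ f₁ f₃ f₄ p + (Q f₃ f₁ f₂ f₄ p + Q f₄ f₁ f₂ f₃ p) := by
    intro p
    have msp := ms p
    have e2 : (sepInd p * (w * f₂)) ⋆ₗ ((w * f₁) ⋆ₗ ((w * f₃) ⋆ₗ (w * f₄))) =
        (w * f₁) ⋆ₗ ((sepInd p * (w * f₂)) ⋆ₗ ((w * f₃) ⋆ₗ (w * f₄))) :=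
      lconvolution_left_comm (by fun_prop) (by fun_prop) (mc (by fun_prop) (by fun_prop))
    have e3 : (sepInd p * (w * f₃)) ⋆ₗ ((w * f₁) ⋆ₗ ((w * f₂) ⋆ₗ (w * f₄))) =
        (w * f₁) ⋆ₗ ((w * f₂) ⋆ₗ ((sepInd p * (w * f₃)) ⋆ₗ (w * f₄))) := by
      rw [lconvolution_left_comm (by fun_prop) (by fun_prop) (mc (by fun_prop) (by fun_prop)),
        lconvolution_left_comm (f := sepInd p * (w * f₃)) (by fun_prop) (by fun_prop) (by fun_prop)]
    have e4 : (sepInd p * (w * f₄)) ⋆ₗ ((w * f₁) ⋆ₗ ((w * f₂) ⋆ₗ (w * f₃))) =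
        (w * f₁) ⋆ₗ ((w * f₂) ⋆ₗ ((w * f₃) ⋆ₗ (sepInd p * (w * f₄)))) := by
      rw [lconvolution_left_comm (by fun_prop) (by fun_prop) (mc (by fun_prop) (by fun_prop)),
        lconvolution_left_comm (f := sepInd p * (w * f₄)) (by fun_prop) (by fun_prop) (by fun_prop),
        lconvolution_comm (f := sepInd p * (w * f₄))]
    simp only [hQ]
    rw [← mul_add, ← mul_add, ← mul_add, e2, e3, e4]
    gcongr
    obtain ⟨A₁, hA₁⟩ : ∃ A, A = w * f₁ := ⟨_, rfl⟩
    obtain ⟨A₂, hA₂⟩ : ∃ A, A = w * f₂ := ⟨_, rfl⟩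
    obtain ⟨A₃, hA₃⟩ : ∃ A, A = w * f₃ := ⟨_, rfl⟩
    obtain ⟨A₄, hA₄⟩ : ∃ A, A = w * f₄ := ⟨_, rfl⟩
    have n₁ : Measurable A₁ := by rw [hA₁]; fun_prop
    have n₂ : Measurable A₂ := by rw [hA₂]; fun_prop
    have n₃ : Measurable A₃ := by rw [hA₃]; fun_prop
    have n₄ : Measurable A₄ := by rw [hA₄]; fun_prop
    rw [← hA₁, ← hA₂, ← hA₃, ← hA₄]
    exact lconvolution_le_add_of_one_le p msp n₁ n₂ n₃ n₄ (one_le_sepInd p)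
  calc _ ≤ ∫⁻ p, 16 * (Q f₁ f₂ f₃ f₄ p ^ 2 + (Q f₂ f₁ f₃ f₄ p ^ 2 +
        (Q f₃ f₁ f₂ f₄ p ^ 2 + Q f₄ f₁ f₂ f₃ p ^ 2))) := by
        refine lintegral_mono fun p => ?_
        refine (pow_le_pow_left' (hconv p) 2).trans ((ennreal_add_sq_le _ _).trans ?_)
        calc _ ≤ 4 * (4 * (Q f₁ f₂ f₃ f₄ p ^ 2 + Q f₂ f₁ f₃ f₄ p ^ 2) +
              4 * (Q f₃ f₁ f₂ f₄ p ^ 2 + Q f₄ f₁ f₂ f₃ p ^ 2)) := by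
              gcongr <;> exact ennreal_add_sq_le _ _
          _ = _ := by ring
    _ = 16 * ((∫⁻ p, Q f₁ f₂ f₃ f₄ p ^ 2) + ((∫⁻ p, Q f₂ f₁ f₃ f₄ p ^ 2) +
        ((∫⁻ p, Q f₃ f₁ f₂ f₄ p ^ 2) + ∫⁻ p, Q f₄ f₁ f₂ f₃ p ^ 2))) := by
        have m1 := mQ m₁ m₂ m₃ m₄
        have m2 := mQ m₂ m₁ m₃ m₄
        have m3 := mQ m₃ m₁ m₂ m₄
        rw [lintegral_const_mul' _ _ (by finiteness), lintegral_add_left (by fun_prop),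
          lintegral_add_left (by fun_prop), lintegral_add_left (by fun_prop)]
    _ ≤ 16 * (C * _ + (C * _ + (C * _ + C * _))) := by
        simp only [hQ]
        gcongr
        · exact hC f₁ f₂ f₃ f₄ m₁ m₂ m₃ m₄
        · exact hC f₂ f₁ f₃ f₄ m₂ m₁ m₃ m₄
        · exact hC f₃ f₁ f₂ f₄ m₃ m₁ m₂ m₄
        · exact hC f₄ f₁ f₂ f₃ m₄ m₁ m₂ m₃
    _ = _ := by
        push_cast
        ring

lemma XNorm_sq (s b : ℝ) (u : ℝ → ℝ → ℂ) : XNorm 0 s b u ^ 2 =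
    ∫⁻ p : ℝ × ℝ, (ENNReal.ofReal (jap s p.2 * jap b (p.1 - p.2 ^ 3)) *
      ‖FT2 u p.1 p.2‖ₑ) ^ 2 := by
  have h := eLpNorm_nnreal_pow_eq_lintegral (μ := volume) (p := 2) (f := fun p : ℝ × ℝ =>
    ((Real.exp (0 * |p.2|) * jap s p.2 * jap b (p.1 - p.2 ^ 3) : ℝ) : ℂ) * FT2 u p.1 p.2)
    two_ne_zero
  simp only [NNReal.coe_ofNat, ENNReal.rpow_two, ENNReal.coe_ofNat] at h
  rw [XNorm, h]
  refine lintegral_congr fun p => ?_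
  rw [enorm_mul, zero_mul, Real.exp_zero, one_mul, ← ofReal_norm, Complex.norm_real,
    Real.norm_of_nonneg (mul_nonneg (jap_nonneg _ _) (jap_nonneg _ _))]

lemma jap_add_le {δ : ℝ} (hδ : 0 ≤ δ) (x y : ℝ) :
    jap δ (x + y) ≤ 2 ^ (δ / 2) * (jap δ x * jap δ y) := by
  unfold jap
  rw [← Real.mul_rpow (by positivity) (by positivity), ← Real.mul_rpow (by positivity) (by positivity)]
  refine Real.rpow_le_rpow (by positivity) ?_ (by positivity)
  nlinarith [sq_nonneg (x - y), sq_nonneg (x * y)]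

lemma lconvolution_mono {f f' g g' : ℝ × ℝ → ℝ≥0∞} (hf : f ≤ f') (hg : g ≤ g') :
    f ⋆ₗ g ≤ f' ⋆ₗ g' := fun p => by
  rw [lconvolution_apply, lconvolution_apply]
  exact lintegral_mono fun q => mul_le_mul' (hf q) (hg _)

/-- A submultiplicative weight distributes over a convolution. -/
lemma mul_lconvolution_le {J f g : ℝ × ℝ → ℝ≥0∞} {c : ℝ≥0∞} (hc : c ≠ ⊤)
    (hJ : ∀ p q, J (p + q) ≤ c * (J p * J q)) (p : ℝ × ℝ) (hp : J p ≠ ⊤) :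
    J p * (f ⋆ₗ g) p ≤ c * ((J * f) ⋆ₗ (J * g)) p := by
  rw [lconvolution_apply, lconvolution_apply, ← lintegral_const_mul' _ _ hp,
    ← lintegral_const_mul' _ _ hc]
  refine lintegral_mono fun q => ?_
  simp only [Pi.mul_apply]
  calc J p * (f q * g (p - q)) = J (q + (p - q)) * (f q * g (p - q)) := by
        rw [add_sub_cancel]
    _ ≤ c * (J q * J (p - q)) * (f q * g (p - q)) := by gcongr; exact hJ _ _
    _ = _ := by ring

lemma mul_lconvolution_four_le {J g₁ g₂ g₃ g₄ : ℝ × ℝ → ℝ≥0∞} {c : ℝ≥0} (hJt : ∀ p, J p ≠ ⊤)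
    (hJ : ∀ p q, J (p + q) ≤ c * (J p * J q)) (p : ℝ × ℝ) :
    J p * (g₁ ⋆ₗ (g₂ ⋆ₗ (g₃ ⋆ₗ g₄))) p ≤
      (c ^ 3 : ℝ≥0) * ((J * g₁) ⋆ₗ ((J * g₂) ⋆ₗ ((J * g₃) ⋆ₗ (J * g₄)))) p := by
  have hstep : ∀ {f g h : ℝ × ℝ → ℝ≥0∞} {d : ℝ≥0}, (∀ p, J p * g p ≤ d * h p) →
      ∀ p, J p * (f ⋆ₗ g) p ≤ (c * d : ℝ≥0) * ((J * f) ⋆ₗ h) p := by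
    intro f g h d hgh p
    refine (mul_lconvolution_le ENNReal.coe_ne_top hJ p (hJt p)).trans ?_
    rw [ENNReal.coe_mul, mul_assoc]
    gcongr
    rw [lconvolution_apply, lconvolution_apply, ← lintegral_const_mul' _ _ ENNReal.coe_ne_top]
    refine lintegral_mono fun q => ?_
    refine (mul_le_mul_right (hgh (p - q)) _).trans_eq ?_
    ring
  refine (hstep (hstep (hstep (d := 1) (h := J * g₄) fun q => by simp)) p).trans_eq ?_
  rw [show c * (c * (c * 1)) = c ^ 3 by ring]

lemma ofReal_jap_mul_le {s b r δ β : ℝ} (hs : s = δ - r) (hβ : β ≤ b) (p : ℝ × ℝ) (G : ℝ≥0∞) :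
    ENNReal.ofReal (jap δ p.2) * G ≤ inWeight r β p *
      (ENNReal.ofReal (jap s p.2 * jap b (p.1 - p.2 ^ 3)) * G) := by
  rw [← mul_assoc, inWeight, ← ENNReal.ofReal_mul (bourgainWeight_pos _ _ _).le]
  gcongr
  have h : bourgainWeight r β p * (jap s p.2 * jap b (p.1 - p.2 ^ 3)) =
      jap δ p.2 * jap (b - β) (p.1 - p.2 ^ 3) := by
    rw [bourgainWeight, hs, show δ = r + (δ - r) by ring, jap_add, sub_eq_neg_add b, jap_add (-β)]
    ring_nf
  rw [h]
  exact le_mul_of_one_le_right (jap_nonneg _ _) (one_le_jap (by linarith) _)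

lemma le_sqrt_mul_of_sq_le {x y : ℝ≥0∞} {M : ℝ≥0} (h : x ^ 2 ≤ M * y ^ 2) :
    x ≤ ENNReal.ofReal (NNReal.sqrt M + 1) * y := by
  have h1 : x ^ 2 ≤ ((NNReal.sqrt M : ℝ≥0∞) * y) ^ 2 := by
    rw [mul_pow, ← ENNReal.coe_pow, NNReal.sq_sqrt]
    exact h
  refine ((ENNReal.pow_le_pow_left_iff two_ne_zero).1 h1).trans ?_
  gcongr
  rw [← ENNReal.ofReal_coe_nnreal]
  exact ENNReal.ofReal_le_ofReal (by linarith)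

/-- Quadrilinear estimate in Bourgain spaces: for `s > -1/6`, `b > 1/2`, and `b'` with
`-1/2 < b' < s - 1/3` if `-1/6 < s ≤ 0` and `-1/2 < b' < -1/3` if `s ≥ 0`, one has
`‖∂_x(u₁u₂u₃u₄)‖_{X^{s,b'}} ≤ C ∏ ‖uⱼ‖_{X^{s,b}}` for Schwartz `u₁,…,u₄`. -/
theorem quadrilinear_Xsb (s b b' : ℝ) (hs : -(1/6) < s) (hb : 1/2 < b)
    (hb'₁ : -(1/2) < b') (hb'₂ : s ≤ 0 → b' < s - 1/3) (hb'₃ : 0 ≤ s → b' < -(1/3)) :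
    ∃ C > (0 : ℝ), ∀ u₁ u₂ u₃ u₄ : ℝ → ℝ → ℂ,
      IsSchwartz u₁ → IsSchwartz u₂ → IsSchwartz u₃ → IsSchwartz u₄ →
      XNorm 0 s b' (fun t x => deriv (fun y => u₁ t y * u₂ t y * u₃ t y * u₄ t y) x) ≤
        ENNReal.ofReal C *
          (XNorm 0 s b u₁ * XNorm 0 s b u₂ * XNorm 0 s b u₃ * XNorm 0 s b u₄) := by
  obtain ⟨r, δ, hr, hδ, hsδ, hr6, hrb⟩ : ∃ r δ : ℝ, 0 ≤ r ∧ 0 ≤ δ ∧ s = δ - r ∧ r < 1 / 6 ∧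
      b' < -r - 1 / 3 := by
    rcases le_total s 0 with h | h
    · exact ⟨-s, 0, by linarith, le_rfl, by ring, by linarith, by linarith [hb'₂ h]⟩
    · exact ⟨0, s, le_rfl, h, by ring, by norm_num, by linarith [hb'₃ h]⟩
  obtain ⟨β, hβ, hβ'⟩ : ∃ β, 1 / 2 < β ∧ β < min b (1 / 6 - r - b') :=
    exists_between (lt_min hb (by linarith))
  obtain ⟨hβb, hβr⟩ := lt_min_iff.1 hβ'
  obtain ⟨C, hC⟩ := exists_lintegral_sq_lconvolution_le (r := r) (b := β) (b' := b') hr hβ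
    (by linarith) (by linarith) (by linarith)
  set c : ℝ≥0 := Real.toNNReal (2 ^ (δ / 2)) with hc
  refine ⟨NNReal.sqrt ((c ^ 3) ^ 2 * C) + 1, by positivity, ?_⟩
  rintro u₁ u₂ u₃ u₄ ⟨φ₁, h₁⟩ ⟨φ₂, h₂⟩ ⟨φ₃, h₃⟩ ⟨φ₄, h₄⟩
  obtain rfl : u₁ = fun t x => φ₁ (t, x) := by ext t x; exact h₁ t x
  obtain rfl : u₂ = fun t x => φ₂ (t, x) := by ext t x; exact h₂ t x
  obtain rfl : u₃ = fun t x => φ₃ (t, x) := by ext t x; exact h₃ t x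
  obtain rfl : u₄ = fun t x => φ₄ (t, x) := by ext t x; exact h₄ t x
  refine le_sqrt_mul_of_sq_le ?_
  simp only [mul_pow, XNorm_sq]
  set W : ℝ × ℝ → ℝ≥0∞ := fun p => ENNReal.ofReal (jap s p.2 * jap b (p.1 - p.2 ^ 3)) with hW
  have mW : Measurable W := by fun_prop
  have mft : ∀ φ : SchwartzMap (ℝ × ℝ) ℂ, Measurable fun p => ‖ft φ p‖ₑ := fun φ =>
    (continuous_ft φ).measurable.enorm
  set f : SchwartzMap (ℝ × ℝ) ℂ → ℝ × ℝ → ℝ≥0∞ := fun φ p => W p * ‖ft φ p‖ₑ with hf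
  have mf : ∀ φ, Measurable (f φ) := fun φ => mW.mul (mft φ)
  set J : ℝ × ℝ → ℝ≥0∞ := fun p => ENNReal.ofReal (jap δ p.2) with hJ
  have hJadd : ∀ p q, J (p + q) ≤ c * (J p * J q) := fun p q => by
    rw [hJ, ← ENNReal.ofReal_mul (jap_nonneg _ _), hc, ENNReal.ofNNReal_toNNReal,
      ← ENNReal.ofReal_mul (by positivity)]
    exact ENNReal.ofReal_le_ofReal (jap_add_le hδ _ _)
  have hJf : ∀ φ, (J * fun p => ‖ft φ p‖ₑ) ≤ inWeight r β * f φ := fun φ p =>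
    ofReal_jap_mul_le hsδ hβb.le p _
  have key : ∀ p : ℝ × ℝ, ENNReal.ofReal (jap s p.2 * jap b' (p.1 - p.2 ^ 3)) *
      ‖FT2 (fun t x => deriv (fun y => φ₁ (t, y) * φ₂ (t, y) * φ₃ (t, y) * φ₄ (t, y)) x)
        p.1 p.2‖ₑ ≤ (c ^ 3 : ℝ≥0) * (outWeight r b' p * ((inWeight r β * f φ₁) ⋆ₗ
        ((inWeight r β * f φ₂) ⋆ₗ ((inWeight r β * f φ₃) ⋆ₗ (inWeight r β * f φ₄)))) p) := by
    intro p
    have h := enorm_FT2_deriv_mul_le φ₁ φ₂ φ₃ φ₄ p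
    simp_rw [← lconvolution_apply (fun q => ‖ft φ₃ q‖ₑ) (fun q => ‖ft φ₄ q‖ₑ),
      ← lconvolution_apply (fun q => ‖ft φ₂ q‖ₑ), ← lconvolution_apply (fun q => ‖ft φ₁ q‖ₑ)] at h
    have hw : ENNReal.ofReal (jap s p.2 * jap b' (p.1 - p.2 ^ 3)) * ENNReal.ofReal |p.2| =
        outWeight r b' p * J p := by
      rw [outWeight, hJ, ← ENNReal.ofReal_mul (mul_nonneg (jap_nonneg _ _) (jap_nonneg _ _)),
        ← ENNReal.ofReal_mul
          (mul_nonneg (abs_nonneg _) (mul_nonneg (jap_nonneg _ _) (jap_nonneg _ _))),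
        hsδ, sub_eq_add_neg, jap_add]
      ring_nf
    refine (mul_le_mul_right h _).trans ?_
    rw [← mul_assoc, hw, mul_assoc, mul_left_comm _ (outWeight r b' p)]
    refine mul_le_mul_right ?_ _
    refine (mul_lconvolution_four_le (fun _ => ENNReal.ofReal_ne_top) hJadd p).trans ?_
    refine mul_le_mul_right ?_ _
    exact lconvolution_mono (hJf φ₁) (lconvolution_mono (hJf φ₂)
      (lconvolution_mono (hJf φ₃) (hJf φ₄))) p
  simp only [← mul_pow]
  refine (lintegral_mono fun p => pow_le_pow_left' (key p) 2).trans ?_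
  simp_rw [mul_pow ((c ^ 3 : ℝ≥0) : ℝ≥0∞)]
  rw [lintegral_const_mul' _ _ (by finiteness), ENNReal.coe_mul, ENNReal.coe_pow (c ^ 3),
    mul_assoc]
  refine mul_le_mul_right ?_ _
  refine (hC (f φ₁) (f φ₂) (f φ₃) (f φ₄) (mf _) (mf _) (mf _) (mf _)).trans_eq ?_
  simp only [hf, hW, ft]
  ring
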